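/- arXiv:1304.1849 — 5 statements merged into one kernel-verified Lean document; each statement's English description precedes it below -/
import Mathlib

section
/- For every M ≥ 1, T > 0 and c > 1 there exists a constant C > 0, depending only on M, T and c, such that for all admissible parameters (α, θ, ℓ), every integer η ≥ 0, every t ∈ (0, T] and every x ∈ ℝ, one has (𝒞_θ^η Γ^{α,θ,ℓ}(t,·))(x) ≤ C · (𝒞_{cM}^η Γ̄^{cM,cM,cM}(t,·))(x). -/
open Real MeasureTheory

/-- Gaussian density component `Γ_n^{α,θ,ℓ}(t,x)`. -/
noncomputable def Gn (α θ l : ℝ) (n : ℕ) (t x : ℝ) : ℝ :=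
  (Real.sqrt (2 * Real.pi * (α * t + (n : ℝ) * θ)))⁻¹ *
    Real.exp (-(x - (α / 2 + l * (Real.exp (θ / 2) - 1)) * t) ^ 2 / (2 * (α * t + (n : ℝ) * θ)))

/-- Compound-Poisson jump-diffusion density `Γ^{α,θ,ℓ}(t,x)`. -/
noncomputable def G (α θ l : ℝ) (t x : ℝ) : ℝ :=
  Real.exp (-(l * t)) * ∑' n : ℕ, (l * t) ^ n / (Nat.factorial n : ℝ) * Gn α θ l n t x

/-- Centered Gaussian density component `Γ̄_n^{α,θ}(t,x)`. -/
noncomputable def GBn (α θ : ℝ) (n : ℕ) (t x : ℝ) : ℝ :=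
  (Real.sqrt (2 * Real.pi * (α * t + (n : ℝ) * θ)))⁻¹ *
    Real.exp (-x ^ 2 / (2 * (α * t + (n : ℝ) * θ)))

/-- Centered jump-diffusion density `Γ̄^{α,θ,ℓ}(t,x)`. -/
noncomputable def GB (α θ l : ℝ) (t x : ℝ) : ℝ :=
  Real.exp (-(l * t)) * ∑' n : ℕ, (l * t) ^ n / (Nat.factorial n : ℝ) * GBn α θ n t x

/-- Gaussian convolution operator `𝒞_θ`. -/
noncomputable def conv (θ : ℝ) (f : ℝ → ℝ) (x : ℝ) : ℝ :=
  ∫ z : ℝ, f (x + z) * ((Real.sqrt (2 * Real.pi * θ))⁻¹ * Real.exp (-z ^ 2 / (2 * θ)))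

/-- The centered Gaussian density of variance `v`. -/
noncomputable def gauss (v x : ℝ) : ℝ :=
  (Real.sqrt (2 * Real.pi * v))⁻¹ * Real.exp (-x ^ 2 / (2 * v))

lemma gauss_nonneg (v x : ℝ) : 0 ≤ gauss v x := by unfold gauss; positivity

lemma gauss_le_of_le {w v : ℝ} (hw : 0 < w) (hwv : w ≤ v) (x : ℝ) :
    gauss v x ≤ (Real.sqrt (2 * Real.pi * w))⁻¹ := by
  have hv : 0 < v := hw.trans_le hwv
  have hexp : Real.exp (-x ^ 2 / (2 * v)) ≤ 1 :=
    Real.exp_le_one_iff.2 (div_nonpos_of_nonpos_of_nonneg (by nlinarith [sq_nonneg x]) (by positivity))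
  calc gauss v x ≤ (Real.sqrt (2 * Real.pi * v))⁻¹ := mul_le_of_le_one_right (by positivity) hexp
    _ ≤ _ := by gcongr

lemma gauss_add_mul_gauss {v w : ℝ} (hv : 0 < v) (hw : 0 < w) (y z : ℝ) :
    gauss v (y + z) * gauss w z =
      gauss (v + w) y * gauss (v * w / (v + w)) (z + w * y / (v + w)) := by
  have hvw : 0 < v + w := add_pos hv hw
  have hprefactor : (Real.sqrt (2 * Real.pi * v))⁻¹ * (Real.sqrt (2 * Real.pi * w))⁻¹ =
      (Real.sqrt (2 * Real.pi * (v + w)))⁻¹ *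
        (Real.sqrt (2 * Real.pi * (v * w / (v + w))))⁻¹ := by
    rw [← mul_inv, ← mul_inv, ← Real.sqrt_mul (by positivity), ← Real.sqrt_mul (by positivity)]
    congr 2
    field_simp
  unfold gauss
  rw [mul_mul_mul_comm, mul_mul_mul_comm (Real.sqrt (2 * Real.pi * (v + w)))⁻¹, hprefactor,
    ← Real.exp_add, ← Real.exp_add]
  congr 2
  field_simp
  ring

lemma gauss_eq_exp_neg_mul_sq (v x : ℝ) :
    gauss v x = (Real.sqrt (2 * Real.pi * v))⁻¹ * Real.exp (-(1 / (2 * v)) * x ^ 2) := by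
  unfold gauss
  congr 2
  ring

lemma integrable_gauss {v : ℝ} (hv : 0 < v) : Integrable (gauss v) := by
  rw [funext (gauss_eq_exp_neg_mul_sq v)]
  exact (integrable_exp_neg_mul_sq (by positivity)).const_mul _

lemma integral_gauss {v : ℝ} (hv : 0 < v) : ∫ x, gauss v x = 1 := by
  simp_rw [gauss_eq_exp_neg_mul_sq]
  rw [integral_const_mul, integral_gaussian,
    show Real.pi / (1 / (2 * v)) = 2 * Real.pi * v by field_simp]
  exact inv_mul_cancel₀ (by positivity)

lemma integrable_gauss_add_mul_gauss {v w : ℝ} (hv : 0 < v) (hw : 0 < w) (y : ℝ) :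
    Integrable fun z => gauss v (y + z) * gauss w z := by
  simp_rw [gauss_add_mul_gauss hv hw]
  exact ((integrable_gauss (by positivity)).comp_add_right _).const_mul _

lemma integral_gauss_add_mul_gauss {v w : ℝ} (hv : 0 < v) (hw : 0 < w) (y : ℝ) :
    ∫ z, gauss v (y + z) * gauss w z = gauss (v + w) y := by
  simp_rw [gauss_add_mul_gauss hv hw]
  rw [integral_const_mul,
    integral_add_right_eq_self (gauss (v * w / (v + w))), integral_gauss (by positivity), mul_one]

lemma summable_mul_gauss {a v : ℕ → ℝ} {w : ℝ} (ha : ∀ n, 0 ≤ a n) (hs : Summable a)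
    (hw : 0 < w) (hv : ∀ n, w ≤ v n) (x : ℝ) : Summable fun n => a n * gauss (v n) x :=
  (hs.mul_right (Real.sqrt (2 * Real.pi * w))⁻¹).of_nonneg_of_le
    (fun n => mul_nonneg (ha n) (gauss_nonneg _ _))
    (fun n => mul_le_mul_of_nonneg_left (gauss_le_of_le hw (hv n) x) (ha n))

lemma conv_tsum_gauss {a v : ℕ → ℝ} {w : ℝ} (ha : ∀ n, 0 ≤ a n) (hs : Summable a)
    (hw : 0 < w) (hv : ∀ n, 0 < v n) (m : ℝ) :
    conv w (fun x => ∑' n, a n * gauss (v n) (x - m)) =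
      fun x => ∑' n, a n * gauss (v n + w) (x - m) := by
  funext x
  have hint (n : ℕ) : ∫ z, a n * (gauss (v n) (x - m + z) * gauss w z) =
      a n * gauss (v n + w) (x - m) := by
    rw [integral_const_mul, integral_gauss_add_mul_gauss (hv n) hw]
  have hnorm (n : ℕ) (z : ℝ) : ‖a n * (gauss (v n) (x - m + z) * gauss w z)‖ =
      a n * (gauss (v n) (x - m + z) * gauss w z) :=
    Real.norm_of_nonneg
      (mul_nonneg (ha n) (mul_nonneg (gauss_nonneg _ _) (gauss_nonneg _ _)))
  calc conv w (fun x => ∑' n, a n * gauss (v n) (x - m)) x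
      = ∫ z, ∑' n, a n * (gauss (v n) (x - m + z) * gauss w z) := by
        refine integral_congr_ae (.of_forall fun z => ?_)
        change (∑' n, a n * gauss (v n) (x + z - m)) * gauss w z = _
        rw [← tsum_mul_right]
        refine tsum_congr fun n => ?_
        rw [add_sub_right_comm, mul_assoc]
    _ = ∑' n, ∫ z, a n * (gauss (v n) (x - m + z) * gauss w z) := by
        refine (integral_tsum_of_summable_integral_norm
          (fun n => (integrable_gauss_add_mul_gauss (hv n) hw _).const_mul _) ?_).symm
        simp_rw [hnorm, hint]
        exact summable_mul_gauss ha hs hw (fun n => by linarith [hv n]) _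
    _ = _ := tsum_congr hint

lemma iterate_conv_tsum_gauss {a v : ℕ → ℝ} {w : ℝ} (ha : ∀ n, 0 ≤ a n) (hs : Summable a)
    (hw : 0 < w) (hv : ∀ n, 0 < v n) (m : ℝ) (k : ℕ) :
    (conv w)^[k] (fun x => ∑' n, a n * gauss (v n) (x - m)) =
      fun x => ∑' n, a n * gauss (v n + k * w) (x - m) := by
  induction k with
  | zero => simp
  | succ k ih =>
    rw [Function.iterate_succ_apply', ih,
      conv_tsum_gauss ha hs hw (fun n => add_pos_of_pos_of_nonneg (hv n) (by positivity))]
    push_cast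
    simp_rw [add_mul, one_mul, add_assoc]

/-- The probability that a Poisson variable of rate `r` equals `n`. -/
noncomputable def poissonWeight (r : ℝ) (n : ℕ) : ℝ :=
  Real.exp (-r) * (r ^ n / (Nat.factorial n : ℝ))

lemma poissonWeight_nonneg {r : ℝ} (hr : 0 ≤ r) (n : ℕ) : 0 ≤ poissonWeight r n := by
  unfold poissonWeight; positivity

lemma summable_poissonWeight (r : ℝ) : Summable (poissonWeight r) :=
  (Real.summable_pow_div_factorial r).mul_left _

lemma poissonWeight_le {r s : ℝ} (hr : 0 ≤ r) (hrs : r ≤ s) (n : ℕ) :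
    poissonWeight r n ≤ Real.exp s * poissonWeight s n := by
  unfold poissonWeight
  rw [← mul_assoc, ← Real.exp_add, add_neg_cancel, Real.exp_zero]
  gcongr
  exact Real.exp_le_one_iff.2 (neg_nonpos.2 hr)

lemma G_eq_tsum_gauss (α θ l t : ℝ) :
    G α θ l t = fun x => ∑' n : ℕ, poissonWeight (l * t) n *
      gauss (α * t + n * θ) (x - (α / 2 + l * (Real.exp (θ / 2) - 1)) * t) := by
  funext x
  simp_rw [G, poissonWeight, mul_assoc (Real.exp _), tsum_mul_left]
  rfl

lemma GB_eq_tsum_gauss (α θ l t : ℝ) :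
    GB α θ l t = fun x => ∑' n : ℕ, poissonWeight (l * t) n *
      gauss (α * t + n * θ) (x - 0) := by
  funext x
  simp_rw [GB, poissonWeight, mul_assoc (Real.exp _), tsum_mul_left, sub_zero]
  rfl

lemma iterate_conv_G {α θ l t : ℝ} (hα : 0 < α) (hθ : 0 < θ) (hl : 0 ≤ l) (ht : 0 < t)
    (k : ℕ) (x : ℝ) :
    (conv θ)^[k] (G α θ l t) x = ∑' n : ℕ, poissonWeight (l * t) n *
      gauss (α * t + n * θ + k * θ) (x - (α / 2 + l * (Real.exp (θ / 2) - 1)) * t) := by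
  rw [G_eq_tsum_gauss, iterate_conv_tsum_gauss (poissonWeight_nonneg (by positivity))
    (summable_poissonWeight _) hθ (fun n => by positivity)]

lemma iterate_conv_GB {α θ l t : ℝ} (hα : 0 < α) (hθ : 0 < θ) (hl : 0 ≤ l) (ht : 0 < t)
    (k : ℕ) (x : ℝ) :
    (conv θ)^[k] (GB α θ l t) x = ∑' n : ℕ, poissonWeight (l * t) n *
      gauss (α * t + n * θ + k * θ) x := by
  rw [GB_eq_tsum_gauss, iterate_conv_tsum_gauss (poissonWeight_nonneg (by positivity))
    (summable_poissonWeight _) hθ (fun n => by positivity)]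
  simp_rw [sub_zero]

/-- A shifted Gaussian density is dominated by a centered one of larger variance, up to a
factor controlled by the ratio of the variances and the size of the shift. -/
lemma gauss_sub_le {v V c K B m : ℝ} (hv : 0 < v) (hc : 1 < c) (hcv : c * v ≤ V)
    (hV : V ≤ K * v) (hm : m ^ 2 ≤ B * v) (x : ℝ) :
    gauss v (x - m) ≤ Real.sqrt K * Real.exp (B / (2 * (c - 1))) * gauss V x := by
  have hc' : 0 < c - 1 := sub_pos.2 hc
  have hc0 : 0 < c := by linarith
  have hV0 : 0 < V := lt_of_lt_of_le (by positivity) hcv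
  have hprefactor : (Real.sqrt (2 * Real.pi * v))⁻¹ ≤
      Real.sqrt K * (Real.sqrt (2 * Real.pi * V))⁻¹ := by
    have hK : 0 ≤ K := by nlinarith
    rw [← div_eq_mul_inv, inv_eq_one_div, div_le_div_iff₀ (by positivity) (by positivity), one_mul,
      ← Real.sqrt_mul hK]
    apply Real.sqrt_le_sqrt
    nlinarith [Real.pi_pos]
  have hexponent : -(x - m) ^ 2 / (2 * v) ≤ B / (2 * (c - 1)) + -x ^ 2 / (2 * V) := by
    have hshift : m ^ 2 / (2 * v * (c - 1)) ≤ B / (2 * (c - 1)) := by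
      rw [div_le_div_iff₀ (by positivity) (by positivity)]
      nlinarith
    have hwiden : x ^ 2 / (2 * V) ≤ x ^ 2 / (2 * (c * v)) := by gcongr
    have hsquare : x ^ 2 / (2 * (c * v)) ≤
        (x - m) ^ 2 / (2 * v) + m ^ 2 / (2 * v * (c - 1)) := by
      have hdiff : (x - m) ^ 2 / (2 * v) + m ^ 2 / (2 * v * (c - 1)) - x ^ 2 / (2 * (c * v)) =
          ((c - 1) * x - c * m) ^ 2 / (2 * v * (c - 1) * c) := by
        field_simp
        ring
      have : 0 ≤ ((c - 1) * x - c * m) ^ 2 / (2 * v * (c - 1) * c) := by positivity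
      linarith
    rw [neg_div, neg_div]
    linarith
  calc gauss v (x - m)
      ≤ (Real.sqrt K * (Real.sqrt (2 * Real.pi * V))⁻¹) *
          Real.exp (B / (2 * (c - 1)) + -x ^ 2 / (2 * V)) :=
        mul_le_mul hprefactor (Real.exp_le_exp.2 hexponent) (by positivity) (by positivity)
    _ = _ := by
        rw [Real.exp_add]
        unfold gauss
        ring

/-- Lemma 5.7: `𝒞_θ^η Γ^{α,θ,ℓ}(t,x) ≤ C 𝒞_{cM}^η Γ̄^{cM,cM,cM}(t,x)` uniformly over
admissible parameters. -/
theorem stmt0 (M T c : ℝ) (hM : 1 ≤ M) (hT : 0 < T) (hc : 1 < c) :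
    ∃ C : ℝ, 0 < C ∧
      ∀ α θ l : ℝ, M⁻¹ ≤ α → α ≤ M → M⁻¹ ≤ θ → θ ≤ M → 0 ≤ l → l ≤ M →
        ∀ η : ℕ, ∀ t ∈ Set.Ioc (0 : ℝ) T, ∀ x : ℝ,
          (conv θ)^[η] (G α θ l t) x ≤ C * (conv (c * M))^[η] (GB (c * M) (c * M) (c * M) t) x := by
  have hM0 : 0 < M := by linarith
  have hc0 : 0 < c := by linarith
  have hcM : 0 < c * M := by positivity
  set D : ℝ := M / 2 + M * (Real.exp (M / 2) - 1)
  refine ⟨Real.exp (c * M * T) * (Real.sqrt (c * M ^ 2) *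
    Real.exp (D ^ 2 * T * M / (2 * (c - 1)))), by positivity, ?_⟩
  intro α θ l hα hαM hθ hθM hl hlM η t ht x
  obtain ⟨ht0, htT⟩ := ht
  have hα0 : 0 < α := lt_of_lt_of_le (by positivity) hα
  have hθ0 : 0 < θ := lt_of_lt_of_le (by positivity) hθ
  have hαM' : 1 ≤ α * M := by rwa [inv_le_iff_one_le_mul₀ hM0] at hα
  have hθM' : 1 ≤ θ * M := by rwa [inv_le_iff_one_le_mul₀ hM0] at hθ
  have hdrift0 : 0 ≤ Real.exp (θ / 2) - 1 := sub_nonneg.2 (Real.one_le_exp (by positivity))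
  have hdrift : (α / 2 + l * (Real.exp (θ / 2) - 1)) ^ 2 ≤ D ^ 2 := by
    simp only [D]
    gcongr
  rw [iterate_conv_G hα0 hθ0 hl ht0, iterate_conv_GB hcM hcM hcM.le ht0, ← tsum_mul_left]
  refine Summable.tsum_le_tsum (fun n => ?_)
    (summable_mul_gauss (poissonWeight_nonneg (by positivity)) (summable_poissonWeight _)
      (w := α * t) (by positivity)
      (fun n => by nlinarith [show 0 ≤ (n : ℝ) * θ by positivity,
        show 0 ≤ (η : ℝ) * θ by positivity]) _)
    ((summable_mul_gauss (poissonWeight_nonneg (by positivity)) (summable_poissonWeight _)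
      (w := c * M * t) (by positivity)
      (fun n => by nlinarith [show 0 ≤ (n : ℝ) * (c * M) by positivity,
        show 0 ≤ (η : ℝ) * (c * M) by positivity]) _).mul_left _)
  have hn : (0 : ℝ) ≤ n := n.cast_nonneg
  have hη : (0 : ℝ) ≤ η := η.cast_nonneg
  have hweight : poissonWeight (l * t) n ≤
      Real.exp (c * M * T) * poissonWeight (c * M * t) n := by
    have hlt : l * t ≤ c * M * t := by
      gcongr
      nlinarith
    refine (poissonWeight_le (by positivity) hlt n).trans ?_
    have := poissonWeight_nonneg (r := c * M * t) (by positivity) n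
    gcongr
  have hgauss := gauss_sub_le (v := α * t + n * θ + η * θ)
    (V := c * M * t + n * (c * M) + η * (c * M)) (c := c) (K := c * M ^ 2) (B := D ^ 2 * T * M)
    (m := (α / 2 + l * (Real.exp (θ / 2) - 1)) * t) (by positivity) hc
    (by
      have : α * t + n * θ + η * θ ≤ M * t + n * M + η * M := by gcongr
      nlinarith)
    (by
      have : t + n + η ≤ (α * M) * t + (θ * M) * n + (θ * M) * η := by
        nlinarith [mul_nonneg (sub_nonneg.2 hαM') ht0.le, mul_nonneg (sub_nonneg.2 hθM') hn,
          mul_nonneg (sub_nonneg.2 hθM') hη]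
      nlinarith)
    (by
      calc ((α / 2 + l * (Real.exp (θ / 2) - 1)) * t) ^ 2
          = (α / 2 + l * (Real.exp (θ / 2) - 1)) ^ 2 * t * (1 * t) := by ring
        _ ≤ D ^ 2 * T * (α * M * t + M * (n * θ + η * θ)) := by
            gcongr
            have : 0 ≤ M * (n * θ + η * θ) := by positivity
            nlinarith
        _ = _ := by ring) x
  calc _ ≤ (Real.exp (c * M * T) * poissonWeight (c * M * t) n) * _ :=
        mul_le_mul hweight hgauss (gauss_nonneg _ _)
          (mul_nonneg (by positivity) (poissonWeight_nonneg (by positivity) n))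
    _ = _ := by ring
end

section
/- For every M ≥ 1, T > 0, integer k ≥ 1 and c > 1 there exists a constant C > 0, depending only on M, T, k and c, such that for all admissible parameters (α, θ, ℓ), every integer n ≥ 0, every t ∈ (0, T] and every x ∈ ℝ, one has |∂_x^k Γ_n^{α,θ,ℓ}(t,x)| ≤ C (αt + nθ)^{−k/2} Γ_n^{cα,cθ,ℓ}(t,x), where ∂_x^k denotes the k-th derivative in the spatial variable x. -/
open Real MeasureTheory

/-- A real polynomial is dominated by any Gaussian growth rate. -/
lemma Polynomial.exists_abs_eval_le_exp_sq (p : Polynomial ℝ) {η : ℝ} (hη : 0 < η) :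
    ∃ B : ℝ, 0 < B ∧ ∀ z : ℝ, |p.eval z| ≤ B * Real.exp (η * z ^ 2) := by
  induction p using Polynomial.induction_on' with
  | add p q hp hq =>
    obtain ⟨B₁, hB₁, h₁⟩ := hp
    obtain ⟨B₂, hB₂, h₂⟩ := hq
    refine ⟨B₁ + B₂, by positivity, fun z => ?_⟩
    rw [Polynomial.eval_add, add_mul]
    exact (abs_add_le _ _).trans (add_le_add (h₁ z) (h₂ z))
  | monomial n a =>
    refine ⟨|a| * (1 + n.factorial / η ^ n) + 1, by positivity, fun z => ?_⟩
    have hexp : 1 ≤ Real.exp (η * z ^ 2) := Real.one_le_exp (by positivity)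
    have hpow : (z ^ n) ^ 2 ≤ n.factorial / η ^ n * Real.exp (η * z ^ 2) := by
      have h := Real.pow_div_factorial_le_exp (η * z ^ 2) (by positivity) n
      rw [div_le_iff₀ (by positivity), mul_pow] at h
      rw [div_mul_eq_mul_div, le_div_iff₀ (by positivity), ← pow_mul, mul_comm n 2, pow_mul]
      linarith
    have habs : |z ^ n| ≤ (1 + n.factorial / η ^ n) * Real.exp (η * z ^ 2) := by
      nlinarith [sq_abs (z ^ n), sq_nonneg (|z ^ n| - 1), abs_nonneg (z ^ n)]
    rw [Polynomial.eval_monomial, abs_mul, add_mul, mul_assoc]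
    have := mul_le_mul_of_nonneg_left habs (abs_nonneg a)
    linarith

/-- Derivatives of the standard Gaussian are dominated by a Gaussian of slower decay. -/
lemma exists_abs_iteratedDeriv_gaussian_le (k : ℕ) {η : ℝ} (hη : 0 < η) :
    ∃ B : ℝ, 0 < B ∧ ∀ z : ℝ,
      |iteratedDeriv k (fun y : ℝ => Real.exp (-(y ^ 2 / 2))) z| ≤
        B * Real.exp (η * z ^ 2 - z ^ 2 / 2) := by
  obtain ⟨B, hB, h⟩ :=
    ((Polynomial.hermite k).map (Int.castRingHom ℝ)).exists_abs_eval_le_exp_sq hη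
  refine ⟨B, hB, fun z => ?_⟩
  rw [iteratedDeriv_eq_iterate, Polynomial.deriv_gaussian_eq_hermite_mul_gaussian, sub_eq_add_neg,
    Real.exp_add, ← mul_assoc, abs_mul, abs_mul, abs_pow, abs_neg, abs_one, one_pow, one_mul,
    Real.abs_exp]
  have hz := h z
  rw [Polynomial.eval_map, ← algebraMap_int_eq, ← Polynomial.aeval_def] at hz
  gcongr

/-- Derivatives of a rescaled, translated Gaussian in terms of those of the standard one. -/
lemma iteratedDeriv_gaussian_affine (k : ℕ) (A m : ℝ) {s : ℝ} (hs : 0 < s) (x : ℝ) :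
    iteratedDeriv k (fun w : ℝ => A * Real.exp (-(w - m) ^ 2 / (2 * s))) x =
      A * ((√s)⁻¹ ^ k *
        iteratedDeriv k (fun y : ℝ => Real.exp (-(y ^ 2 / 2))) ((√s)⁻¹ * (x - m))) := by
  have hg : ContDiff ℝ k (fun y : ℝ => Real.exp (-(y ^ 2 / 2))) := by fun_prop
  have hrw : (fun w : ℝ => A * Real.exp (-(w - m) ^ 2 / (2 * s))) =
      fun w => A * (fun v => Real.exp (-(((√s)⁻¹ * v) ^ 2 / 2))) (w - m) := by
    funext w
    simp only [mul_pow, inv_pow, Real.sq_sqrt hs.le]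
    congr 2
    field_simp
  rw [hrw, iteratedDeriv_const_mul_field,
    iteratedDeriv_comp_sub_const k (fun v => Real.exp (-(((√s)⁻¹ * v) ^ 2 / 2))) m]
  simp only [iteratedDeriv_comp_const_mul hg]

lemma sub_sq_div_le {c z d K : ℝ} (hc : 1 < c) (hd : d ^ 2 ≤ K) :
    (1 - 1 / c) / 4 * z ^ 2 - z ^ 2 / 2 ≤
      (c + 1) / (c - 1) * K / (2 * c) + -(z - d) ^ 2 / (2 * c) := by
  have hc' : 0 < c - 1 := sub_pos.2 hc
  have hc0 : 0 < c := by linarith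
  have hK : (c + 1) / (c - 1) * d ^ 2 ≤ (c + 1) / (c - 1) * K := by gcongr
  have key : (z - d) ^ 2 ≤ (c + 1) / 2 * z ^ 2 + (c + 1) / (c - 1) * d ^ 2 := by
    have : (c + 1) / 2 * z ^ 2 + (c + 1) / (c - 1) * d ^ 2 - (z - d) ^ 2 =
        ((c - 1) * z + 2 * d) ^ 2 / (2 * (c - 1)) := by
      field_simp
      ring
    have h : 0 ≤ ((c - 1) * z + 2 * d) ^ 2 / (2 * (c - 1)) := by positivity
    linarith
  have hl : (1 - 1 / c) / 4 * z ^ 2 - z ^ 2 / 2 = -((c + 1) / 2 * z ^ 2) / (2 * c) := by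
    field_simp
    ring
  rw [hl, ← add_div]
  gcongr
  linarith

/-- The drift changes by a bounded multiple of `t` when `(α, θ)` is scaled by `c`. -/
lemma drift_sub_sq_le {M c α θ l : ℝ} (hc : 1 < c) (hα₀ : 0 ≤ α) (hα : α ≤ M) (hθ₀ : 0 ≤ θ)
    (hθ : θ ≤ M) (hl₀ : 0 ≤ l) (hl : l ≤ M) :
    (c * α / 2 + l * (Real.exp (c * θ / 2) - 1) - (α / 2 + l * (Real.exp (θ / 2) - 1))) ^ 2 ≤
      ((c - 1) * M / 2 + M * Real.exp (c * M / 2)) ^ 2 := by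
  have hexp : Real.exp (θ / 2) ≤ Real.exp (c * θ / 2) := Real.exp_le_exp.2 (by nlinarith)
  have hexp' : Real.exp (c * θ / 2) ≤ Real.exp (c * M / 2) := Real.exp_le_exp.2 (by nlinarith)
  have h₁ : l * Real.exp (θ / 2) ≤ l * Real.exp (c * θ / 2) := by gcongr
  have h₂ : l * Real.exp (c * θ / 2) ≤ M * Real.exp (c * M / 2) := by gcongr; linarith
  have h₃ : (c - 1) * α ≤ (c - 1) * M := by gcongr
  have h₄ : 0 ≤ (c - 1) * α := mul_nonneg (by linarith) hα₀
  have h₅ : 0 ≤ l * Real.exp (θ / 2) := by positivity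
  apply pow_le_pow_left₀ <;> nlinarith

/-- Lemma 5.8: spatial-derivative bound `|∂_x^k Γ_n^{α,θ,ℓ}(t,x)| ≤ C (αt+nθ)^{-k/2} Γ_n^{cα,cθ,ℓ}(t,x)`. -/
theorem stmt1 (M T : ℝ) (k : ℕ) (c : ℝ) (hM : 1 ≤ M) (hT : 0 < T) (hk : 1 ≤ k) (hc : 1 < c) :
    ∃ C : ℝ, 0 < C ∧
      ∀ α θ l : ℝ, M⁻¹ ≤ α → α ≤ M → M⁻¹ ≤ θ → θ ≤ M → 0 ≤ l → l ≤ M →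
        ∀ n : ℕ, ∀ t ∈ Set.Ioc (0 : ℝ) T, ∀ x : ℝ,
          |iteratedDeriv k (fun w => Gn α θ l n t w) x| ≤
            C * (α * t + (n : ℝ) * θ) ^ (-(k : ℝ) / 2) * Gn (c * α) (c * θ) l n t x := by
  have hc0 : 0 < c := by linarith
  have hM0 : 0 < M := by linarith
  have hη : 0 < (1 - 1 / c) / 4 := by
    have : 1 / c < 1 := by rwa [div_lt_one hc0]
    linarith
  obtain ⟨B, hB, hBk⟩ := exists_abs_iteratedDeriv_gaussian_le k hη
  set K := ((c - 1) * M / 2 + M * Real.exp (c * M / 2)) ^ 2 * (T * M) with hKdef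
  refine ⟨√c * B * Real.exp ((c + 1) / (c - 1) * K / (2 * c)), by positivity, ?_⟩
  rintro α θ l hα₀ hα hθ₀ hθ hl₀ hl n t ⟨ht₀, ht⟩ x
  have hMinv : 0 < M⁻¹ := by positivity
  have hα_pos : 0 < α := hMinv.trans_le hα₀
  have hθ_pos : 0 < θ := hMinv.trans_le hθ₀
  set s := α * t + (n : ℝ) * θ with hs_def
  have hs : 0 < s := by positivity
  have hts : t ≤ M * s := by
    have h₁ : M⁻¹ * t ≤ s := (mul_le_mul_of_nonneg_right hα₀ ht₀.le).trans
      (le_add_of_nonneg_right (by positivity))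
    rwa [inv_mul_le_iff₀ hM0] at h₁
  set b := α / 2 + l * (Real.exp (θ / 2) - 1) with hb
  set b' := c * α / 2 + l * (Real.exp (c * θ / 2) - 1) with hb'
  set z := (√s)⁻¹ * (x - b * t) with hz
  set d := (√s)⁻¹ * ((b' - b) * t) with hd
  have hdK : d ^ 2 ≤ K := by
    have hdrift := drift_sub_sq_le hc hα_pos.le hα hθ_pos.le hθ hl₀ hl
    have ht2 : t ^ 2 / s ≤ T * M := by
      rw [div_le_iff₀ hs]
      nlinarith
    calc d ^ 2 = (b' - b) ^ 2 * (t ^ 2 / s) := by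
          rw [hd, mul_pow, inv_pow, Real.sq_sqrt hs.le]
          ring
      _ ≤ K := by
          rw [hKdef]
          gcongr
  have hpow : s ^ (-(k : ℝ) / 2) = (√s)⁻¹ ^ k := by
    rw [Real.sqrt_eq_rpow, ← Real.rpow_neg hs.le, ← Real.rpow_natCast, ← Real.rpow_mul hs.le]
    congr 1
    ring
  have hscaled : Gn (c * α) (c * θ) l n t x =
      (√c * √(2 * π * s))⁻¹ * Real.exp (-(z - d) ^ 2 / (2 * c)) := by
    have hcs : c * α * t + (n : ℝ) * (c * θ) = c * s := by rw [hs_def]; ring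
    have hsq : (z - d) ^ 2 = (x - b' * t) ^ 2 / s := by
      rw [hz, hd, ← mul_sub, mul_pow, inv_pow, Real.sq_sqrt hs.le]
      ring
    rw [Gn, hcs, ← hb', hsq, ← Real.sqrt_mul hc0.le]
    congr 2
    · ring_nf
    · field_simp
  have hderiv : iteratedDeriv k (fun w => Gn α θ l n t w) x =
      (√(2 * π * s))⁻¹ * ((√s)⁻¹ ^ k *
        iteratedDeriv k (fun y : ℝ => Real.exp (-(y ^ 2 / 2))) z) :=
    iteratedDeriv_gaussian_affine k _ _ hs x
  rw [hderiv, hscaled, hpow, abs_mul, abs_mul, abs_of_nonneg (by positivity),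
    abs_of_nonneg (by positivity : 0 ≤ (√s)⁻¹ ^ k)]
  calc (√(2 * π * s))⁻¹ * ((√s)⁻¹ ^ k *
        |iteratedDeriv k (fun y : ℝ => Real.exp (-(y ^ 2 / 2))) z|)
      ≤ (√(2 * π * s))⁻¹ * ((√s)⁻¹ ^ k * (B * Real.exp
          ((c + 1) / (c - 1) * K / (2 * c) + -(z - d) ^ 2 / (2 * c)))) := by
        gcongr
        exact (hBk z).trans (mul_le_mul_of_nonneg_left
          (Real.exp_le_exp.2 (sub_sq_div_le hc hdK)) hB.le)
    _ = _ := by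
        have : √c ≠ 0 := (Real.sqrt_pos.2 hc0).ne'
        rw [Real.exp_add, mul_inv]
        field_simp
end

section
/- For every M ≥ 1, T > 0 and integer η ≥ 1 there exists a constant C > 0, depending only on M, T and η, such that for all admissible parameters (α, θ, ℓ), every t ∈ (0, T] and every x ∈ ℝ, one has ℓ t · (𝒞_θ^η Γ^{α,θ,ℓ}(t,·))(x) ≤ C · Γ^{α, 2(η+1)θ, ℓ}(t,x). -/
open Real MeasureTheory

/-- The centered Gaussian density with variance `v`. -/
noncomputable def gaussDensity (v x : ℝ) : ℝ :=
  (Real.sqrt (2 * Real.pi * v))⁻¹ * Real.exp (-x ^ 2 / (2 * v))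

lemma gaussDensity_nonneg (v x : ℝ) : 0 ≤ gaussDensity v x := by
  unfold gaussDensity; positivity

lemma gaussDensity_le {v w : ℝ} (hw : 0 < w) (hwv : w ≤ v) (x : ℝ) :
    gaussDensity v x ≤ (Real.sqrt (2 * Real.pi * w))⁻¹ := by
  have hv : 0 < v := hw.trans_le hwv
  unfold gaussDensity
  calc (Real.sqrt (2 * Real.pi * v))⁻¹ * Real.exp (-x ^ 2 / (2 * v))
      ≤ (Real.sqrt (2 * Real.pi * v))⁻¹ * 1 := by
        gcongr
        rw [Real.exp_le_one_iff, neg_div]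
        exact neg_nonpos.2 (by positivity)
    _ ≤ (Real.sqrt (2 * Real.pi * w))⁻¹ := by
        rw [mul_one]; gcongr

lemma gaussDensity_eq_exp_neg_mul (v : ℝ) :
    gaussDensity v = fun x =>
      (Real.sqrt (2 * Real.pi * v))⁻¹ * Real.exp (-(1 / (2 * v)) * x ^ 2) := by
  funext x
  unfold gaussDensity
  congr 2
  ring

lemma integrable_gaussDensity {v : ℝ} (hv : 0 < v) : Integrable (gaussDensity v) := by
  rw [gaussDensity_eq_exp_neg_mul]
  exact (integrable_exp_neg_mul_sq (by positivity)).const_mul _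

lemma integral_gaussDensity {v : ℝ} (hv : 0 < v) : ∫ x, gaussDensity v x = 1 := by
  simp only [gaussDensity_eq_exp_neg_mul]
  rw [integral_const_mul, integral_gaussian,
    show Real.pi / (1 / (2 * v)) = 2 * Real.pi * v by field_simp]
  exact inv_mul_cancel₀ (by positivity)

lemma gaussDensity_mul_gaussDensity {v w : ℝ} (hv : 0 < v) (hw : 0 < w) (x z : ℝ) :
    gaussDensity v (x + z) * gaussDensity w z =
      gaussDensity (v + w) x * gaussDensity (v * w / (v + w)) (z + x * w / (v + w)) := by
  have hvw : 0 < v + w := by positivity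
  unfold gaussDensity
  rw [mul_mul_mul_comm, mul_mul_mul_comm (_ : ℝ)⁻¹ _ (_ : ℝ)⁻¹, ← Real.exp_add, ← Real.exp_add,
    ← mul_inv, ← mul_inv, ← Real.sqrt_mul (by positivity), ← Real.sqrt_mul (by positivity)]
  congr 2
  · congr 1
    field_simp
  · field_simp
    ring

lemma integrable_gaussDensity_mul {v w : ℝ} (hv : 0 < v) (hw : 0 < w) (x : ℝ) :
    Integrable fun z => gaussDensity v (x + z) * gaussDensity w z := by
  simp only [gaussDensity_mul_gaussDensity hv hw]
  exact ((integrable_gaussDensity (v := v * w / (v + w)) (by positivity)).comp_add_right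
    (x * w / (v + w))).const_mul _

lemma integral_gaussDensity_mul {v w : ℝ} (hv : 0 < v) (hw : 0 < w) (x : ℝ) :
    ∫ z, gaussDensity v (x + z) * gaussDensity w z = gaussDensity (v + w) x := by
  simp only [gaussDensity_mul_gaussDensity hv hw]
  rw [integral_const_mul, integral_add_right_eq_self (gaussDensity (v * w / (v + w))),
    integral_gaussDensity (by positivity), mul_one]

/-- The unnormalised Poisson mixture of centered Gaussian densities with variances `v + n θ`. -/
noncomputable def gaussMix (a v θ x : ℝ) : ℝ :=
  ∑' n : ℕ, a ^ n / (Nat.factorial n : ℝ) * gaussDensity (v + n * θ) x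

lemma summable_gaussMix {a v θ : ℝ} (ha : 0 ≤ a) (hv : 0 < v) (hθ : 0 ≤ θ) (x : ℝ) :
    Summable fun n : ℕ => a ^ n / (Nat.factorial n : ℝ) * gaussDensity (v + n * θ) x := by
  refine Summable.of_nonneg_of_le
    (fun n => mul_nonneg (by positivity) (gaussDensity_nonneg _ _)) (fun n => ?_)
    ((Real.summable_pow_div_factorial a).mul_right (Real.sqrt (2 * Real.pi * v))⁻¹)
  have : v ≤ v + n * θ := le_add_of_nonneg_right (by positivity)
  gcongr
  exact gaussDensity_le hv this x

lemma G_eq_gaussMix (α θ l t x : ℝ) :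
    G α θ l t x = Real.exp (-(l * t)) *
      gaussMix (l * t) (α * t) θ (x - (α / 2 + l * (Real.exp (θ / 2) - 1)) * t) := rfl

lemma conv_gaussMix {a v θ : ℝ} (ha : 0 ≤ a) (hv : 0 < v) (hθ : 0 < θ) (b c : ℝ) :
    conv θ (fun x => b * gaussMix a v θ (x - c)) =
      fun x => b * gaussMix a (v + θ) θ (x - c) := by
  funext x
  have hvn : ∀ n : ℕ, 0 < v + n * θ := fun n => by positivity
  have hint : ∀ n : ℕ, ∫ z, a ^ n / (Nat.factorial n : ℝ) *
      (gaussDensity (v + n * θ) (x - c + z) * gaussDensity θ z) =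
        a ^ n / (Nat.factorial n : ℝ) * gaussDensity (v + θ + n * θ) (x - c) := fun n => by
    rw [integral_const_mul, integral_gaussDensity_mul (hvn n) hθ, add_right_comm]
  have hsum := hasSum_integral_of_summable_integral_norm (μ := volume)
    (F := fun (n : ℕ) (z : ℝ) => a ^ n / (Nat.factorial n : ℝ) *
      (gaussDensity (v + n * θ) (x - c + z) * gaussDensity θ z))
    (fun n => (integrable_gaussDensity_mul (hvn n) hθ (x - c)).const_mul _) (by
      have hnorm : ∀ (n : ℕ) (z : ℝ), ‖a ^ n / (Nat.factorial n : ℝ) *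
          (gaussDensity (v + n * θ) (x - c + z) * gaussDensity θ z)‖ =
          a ^ n / (Nat.factorial n : ℝ) *
          (gaussDensity (v + n * θ) (x - c + z) * gaussDensity θ z) := fun n z =>
        Real.norm_of_nonneg (mul_nonneg (by positivity)
          (mul_nonneg (gaussDensity_nonneg _ _) (gaussDensity_nonneg _ _)))
      simp only [hnorm, hint]
      exact summable_gaussMix ha (by positivity) hθ.le _)
  simp only [hint] at hsum
  unfold gaussMix
  rw [hsum.tsum_eq, ← integral_const_mul]
  change (∫ z, b * (∑' n : ℕ, _) * gaussDensity θ z) = _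
  refine integral_congr_ae (Filter.Eventually.of_forall fun z => ?_)
  dsimp only
  rw [mul_assoc, ← tsum_mul_right, add_sub_right_comm]
  simp only [mul_assoc]

lemma conv_iterate_gaussMix {a v θ : ℝ} (ha : 0 ≤ a) (hv : 0 < v) (hθ : 0 < θ) (b c : ℝ)
    (k : ℕ) :
    (conv θ)^[k] (fun x => b * gaussMix a v θ (x - c)) =
      fun x => b * gaussMix a (v + k * θ) θ (x - c) := by
  induction k with
  | zero => simp
  | succ k ih =>
    rw [Function.iterate_succ_apply', ih, conv_gaussMix ha (by positivity) hθ]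
    push_cast
    funext x
    congr 2
    ring

/-- Comparison of two Gaussian densities with different centers, the second being wider. -/
lemma gaussDensity_le_shift {v w r D δ : ℝ} (hv : 0 < v) (hδ : 0 < δ) (hvw : v + δ ≤ w)
    (hr : w ≤ r * v) (y d : ℝ) (hd : d ^ 2 ≤ D) :
    gaussDensity v y ≤ r * Real.exp (D / (2 * δ)) * gaussDensity w (y - d) := by
  have hw : 0 < w := by linarith
  have hwv : 0 < w - v := by linarith
  have hr1 : 1 ≤ r := by
    by_contra! h
    nlinarith
  have hsqrt : (Real.sqrt (2 * Real.pi * v))⁻¹ ≤ r * (Real.sqrt (2 * Real.pi * w))⁻¹ := by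
    rw [← div_eq_mul_inv, le_div_iff₀ (by positivity), inv_mul_le_iff₀ (by positivity)]
    calc Real.sqrt (2 * Real.pi * w) ≤ Real.sqrt (r ^ 2 * (2 * Real.pi * v)) := by
          apply Real.sqrt_le_sqrt
          have : w ≤ r ^ 2 * v := hr.trans (by gcongr; nlinarith)
          nlinarith [Real.pi_pos]
      _ = Real.sqrt (2 * Real.pi * v) * r := by
          rw [Real.sqrt_mul (by positivity), Real.sqrt_sq (by positivity), mul_comm]
  have hexp : -y ^ 2 / (2 * v) ≤ D / (2 * δ) + -(y - d) ^ 2 / (2 * w) := by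
    have hD : d ^ 2 / (2 * (w - v)) ≤ D / (2 * δ) := by
      gcongr
      · exact (sq_nonneg d).trans hd
      · linarith
    have hid : d ^ 2 / (2 * (w - v)) + -(y - d) ^ 2 / (2 * w) - -y ^ 2 / (2 * v) =
        (y * (w - v) + d * v) ^ 2 / (2 * v * w * (w - v)) := by
      field_simp
      ring
    have hpos : 0 ≤ (y * (w - v) + d * v) ^ 2 / (2 * v * w * (w - v)) := by positivity
    linarith
  unfold gaussDensity
  calc (Real.sqrt (2 * Real.pi * v))⁻¹ * Real.exp (-y ^ 2 / (2 * v))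
      ≤ (r * (Real.sqrt (2 * Real.pi * w))⁻¹) *
          Real.exp (D / (2 * δ) + -(y - d) ^ 2 / (2 * w)) := by gcongr
    _ = _ := by rw [Real.exp_add]; ring

lemma tsum_le_two_mul_tsum_of_le_max_one {f g : ℕ → ℝ} {K : ℝ} (hf : Summable f)
    (hg : Summable g) (hg0 : ∀ n, 0 ≤ g n) (hK : 0 ≤ K) (h : ∀ n, f n ≤ K * g (max n 1)) :
    ∑' n, f n ≤ 2 * K * ∑' n, g n := by
  have h0 : f 0 ≤ K * ∑' n, g n :=
    (h 0).trans (mul_le_mul_of_nonneg_left (hg.le_tsum 1 fun n _ => hg0 n) hK)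
  have h1 : ∑' n, f (n + 1) ≤ K * ∑' n, g n := by
    have hg' : Summable fun n => g (n + 1) := (summable_nat_add_iff 1).2 hg
    calc ∑' n, f (n + 1) ≤ ∑' n, K * g (n + 1) :=
          Summable.tsum_le_tsum (fun n => by simpa using h (n + 1))
            ((summable_nat_add_iff 1).2 hf) (hg'.mul_left K)
      _ = K * ∑' n, g (n + 1) := tsum_mul_left
      _ ≤ K * ∑' n, g n := by
          rw [hg.tsum_eq_zero_add]
          exact mul_le_mul_of_nonneg_left (le_add_of_nonneg_left (hg0 0)) hK
  rw [hf.tsum_eq_zero_add]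
  linarith

lemma mul_gaussMix_le {a A v θ D δ : ℝ} {η : ℕ} (ha : 0 ≤ a) (haA : a ≤ A) (hv : 0 < v)
    (hδ : 0 < δ) (hδθ : δ ≤ θ) (hη : 1 ≤ η) (y d : ℝ) (hd : d ^ 2 ≤ D) :
    a * gaussMix a (v + η * θ) θ y ≤
      2 * ((1 + A) * (2 * ((η : ℝ) + 1) * Real.exp (D / (2 * δ)))) *
        gaussMix a v (2 * ((η : ℝ) + 1) * θ) (y - d) := by
  have hθ : 0 < θ := hδ.trans_le hδθ
  have hA : 0 ≤ A := ha.trans haA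
  have hη' : (1 : ℝ) ≤ η := by exact_mod_cast hη
  have hg := summable_gaussMix ha hv (θ := 2 * ((η : ℝ) + 1) * θ) (by positivity) (y - d)
  have hf := (summable_gaussMix ha (v := v + η * θ) (by positivity) hθ.le y).mul_left a
  unfold gaussMix
  rw [← tsum_mul_left]
  refine tsum_le_two_mul_tsum_of_le_max_one hf hg
    (fun n => mul_nonneg (by positivity) (gaussDensity_nonneg _ _)) (by positivity) fun n => ?_
  have hcoef : a * (a ^ n / (Nat.factorial n : ℝ)) ≤
      (1 + A) * (a ^ (max n 1) / (Nat.factorial (max n 1) : ℝ)) := by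
    rcases Nat.eq_zero_or_pos n with rfl | hn
    · simp
      nlinarith
    · rw [max_eq_left hn]
      gcongr
      linarith
  have hmax : ((max n 1 : ℕ) : ℝ) ≤ n + η := by
    have : max n 1 ≤ n + η := by omega
    exact_mod_cast this
  have hmaxn : (n : ℝ) ≤ (max n 1 : ℕ) := by exact_mod_cast le_max_left n 1
  have hmax1 : (1 : ℝ) ≤ (max n 1 : ℕ) := by exact_mod_cast le_max_right n 1
  have hdens : gaussDensity (v + η * θ + n * θ) y ≤
      2 * ((η : ℝ) + 1) * Real.exp (D / (2 * δ)) *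
        gaussDensity (v + (max n 1 : ℕ) * (2 * ((η : ℝ) + 1) * θ)) (y - d) := by
    generalize ((max n 1 : ℕ) : ℝ) = m at *
    refine gaussDensity_le_shift (by positivity) hδ ?_ ?_ y d hd
    · have : (η : ℝ) + n + 1 ≤ m * (2 * (η + 1)) := by nlinarith
      nlinarith [mul_le_mul_of_nonneg_right this hθ.le]
    · have h1 : m * (2 * ((η : ℝ) + 1) * θ) ≤ (n + η) * (2 * ((η : ℝ) + 1) * θ) := by gcongr
      nlinarith [mul_pos (by linarith : (0 : ℝ) < η) hv]
  calc a * (a ^ n / (Nat.factorial n : ℝ) * gaussDensity (v + η * θ + n * θ) y)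
      = a * (a ^ n / (Nat.factorial n : ℝ)) * gaussDensity (v + η * θ + n * θ) y := by ring
    _ ≤ _ := mul_le_mul hcoef hdens (gaussDensity_nonneg _ _) (by positivity)
    _ = _ := by ring

/-- Lemma 5.9: `ℓt 𝒞_θ^η Γ^{α,θ,ℓ}(t,x) ≤ C Γ^{α,2(η+1)θ,ℓ}(t,x)`. -/
theorem stmt2 (M T : ℝ) (η : ℕ) (hM : 1 ≤ M) (hT : 0 < T) (hη : 1 ≤ η) :
    ∃ C : ℝ, 0 < C ∧
      ∀ α θ l : ℝ, M⁻¹ ≤ α → α ≤ M → M⁻¹ ≤ θ → θ ≤ M → 0 ≤ l → l ≤ M →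
        ∀ t ∈ Set.Ioc (0 : ℝ) T, ∀ x : ℝ,
          l * t * (conv θ)^[η] (G α θ l t) x ≤ C * G α (2 * ((η : ℝ) + 1) * θ) l t x := by
  have hM0 : 0 < M := by linarith
  refine ⟨2 * ((1 + M * T) * (2 * ((η : ℝ) + 1) *
    Real.exp ((M * T * Real.exp (((η : ℝ) + 1) * M)) ^ 2 / (2 * M⁻¹)))), by positivity, ?_⟩
  rintro α θ l hα - hθ hθM hl hlM t ⟨ht, htT⟩ x
  have hMi : 0 < M⁻¹ := inv_pos.2 hM0
  have hα0 : 0 < α := hMi.trans_le hα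
  have hθ0 : 0 < θ := hMi.trans_le hθ
  have ha : 0 ≤ l * t := by positivity
  have haA : l * t ≤ M * T := by gcongr
  have hexp : Real.exp (θ / 2) ≤ Real.exp (2 * ((η : ℝ) + 1) * θ / 2) := by
    gcongr
    nlinarith [mul_nonneg (Nat.cast_nonneg (α := ℝ) η) hθ0.le]
  have hexp' : Real.exp (2 * ((η : ℝ) + 1) * θ / 2) ≤ Real.exp (((η : ℝ) + 1) * M) := by
    rw [show 2 * ((η : ℝ) + 1) * θ / 2 = ((η : ℝ) + 1) * θ by ring]
    gcongr
  have hd : (l * t * (Real.exp (2 * ((η : ℝ) + 1) * θ / 2) - Real.exp (θ / 2))) ^ 2 ≤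
      (M * T * Real.exp (((η : ℝ) + 1) * M)) ^ 2 := by
    refine pow_le_pow_left₀ (mul_nonneg ha (sub_nonneg.2 hexp)) ?_ 2
    refine mul_le_mul haA ?_ (sub_nonneg.2 hexp) (by positivity)
    linarith [Real.exp_pos (θ / 2)]
  have key := mul_gaussMix_le ha haA (mul_pos hα0 ht) hMi hθ hη
    (x - (α / 2 + l * (Real.exp (θ / 2) - 1)) * t) _ hd
  rw [show G α θ l t = _ from funext (G_eq_gaussMix α θ l t),
    conv_iterate_gaussMix ha (mul_pos hα0 ht) hθ0, G_eq_gaussMix]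
  rw [show x - (α / 2 + l * (Real.exp (θ / 2) - 1)) * t -
      l * t * (Real.exp (2 * ((η : ℝ) + 1) * θ / 2) - Real.exp (θ / 2)) =
      x - (α / 2 + l * (Real.exp (2 * ((η : ℝ) + 1) * θ / 2) - 1)) * t by ring] at key
  have := mul_le_mul_of_nonneg_left key (Real.exp_pos (-(l * t))).le
  dsimp only
  linarith
end

section
/- For all real α, θ > 0 and ℓ ≥ 0, the function Γ̄^{α,θ,ℓ} is smooth on (0,∞) × ℝ and solves the integro-differential Kolmogorov equation of the constant-coefficient jump-diffusion operator L̄^{α,θ,ℓ}: for every t > 0 and x ∈ ℝ, ∂_t Γ̄^{α,θ,ℓ}(t,x) = (α/2) ∂_xx Γ̄^{α,θ,ℓ}(t,x) + ℓ ∫_ℝ ( Γ̄^{α,θ,ℓ}(t, x+z) − Γ̄^{α,θ,ℓ}(t,x) ) (2πθ)^{-1/2} e^{−z²/(2θ)} dz. -/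
open Real MeasureTheory

/-- Continuous functions growing more slowly than every Gaussian `exp (c ξ²)`, `c > 0`. -/
def SubgaussianGrowth (p : ℝ → ℂ) : Prop :=
  Continuous p ∧ ∀ c : ℝ, 0 < c → ∃ C : ℝ, ∀ ξ : ℝ, ‖p ξ‖ ≤ C * Real.exp (c * ξ ^ 2)

namespace SubgaussianGrowth

lemma mul {p q : ℝ → ℂ} (hp : SubgaussianGrowth p) (hq : SubgaussianGrowth q) :
    SubgaussianGrowth (fun ξ => p ξ * q ξ) := by
  refine ⟨hp.1.mul hq.1, fun c hc => ?_⟩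
  obtain ⟨C, hC⟩ := hp.2 (c / 2) (half_pos hc)
  obtain ⟨D, hD⟩ := hq.2 (c / 2) (half_pos hc)
  refine ⟨C * D, fun ξ => ?_⟩
  calc ‖p ξ * q ξ‖ = ‖p ξ‖ * ‖q ξ‖ := norm_mul _ _
    _ ≤ (C * Real.exp (c / 2 * ξ ^ 2)) * (D * Real.exp (c / 2 * ξ ^ 2)) :=
        mul_le_mul (hC ξ) (hD ξ) (norm_nonneg _) ((norm_nonneg _).trans (hC ξ))
    _ = C * D * (Real.exp (c / 2 * ξ ^ 2) * Real.exp (c / 2 * ξ ^ 2)) := by ring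
    _ = C * D * Real.exp (c * ξ ^ 2) := by rw [← Real.exp_add]; ring_nf

lemma of_le_sq {p : ℝ → ℂ} (hp : Continuous p) {A B : ℝ} (hB : 0 ≤ B) (hA : 0 ≤ A)
    (h : ∀ ξ, ‖p ξ‖ ≤ A + B * ξ ^ 2) : SubgaussianGrowth p := by
  refine ⟨hp, fun c hc => ⟨A + B / c, fun ξ => ?_⟩⟩
  have h0 : 0 ≤ c * ξ ^ 2 := by positivity
  have h1 : c * ξ ^ 2 + 1 ≤ Real.exp (c * ξ ^ 2) := Real.add_one_le_exp _
  calc ‖p ξ‖ ≤ A * 1 + B / c * (c * ξ ^ 2) := by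
        refine (h ξ).trans_eq ?_
        field_simp
    _ ≤ A * Real.exp (c * ξ ^ 2) + B / c * Real.exp (c * ξ ^ 2) := by
        gcongr <;> linarith
    _ = _ := by ring

lemma one : SubgaussianGrowth (fun _ => 1) :=
  of_le_sq continuous_const le_rfl zero_le_one (by simp)

lemma mul_I : SubgaussianGrowth (fun ξ => (ξ : ℂ) * Complex.I) := by
  refine of_le_sq (by fun_prop) zero_le_one zero_le_one fun ξ => ?_
  simp only [norm_mul, Complex.norm_real, Complex.norm_I, mul_one, Real.norm_eq_abs]
  nlinarith [sq_abs ξ, sq_nonneg (|ξ| - 1)]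

end SubgaussianGrowth

/-- The integrand `p(ξ) exp (t ψ(ξ) + i x ξ)` at `q = (t, x)`. -/
noncomputable def fourierKernel (ψ : ℝ → ℝ) (p : ℝ → ℂ) (q : ℝ × ℝ) (ξ : ℝ) : ℂ :=
  p ξ * Complex.exp (q.1 * ψ ξ + q.2 * (ξ * Complex.I))

section FourierKernel

variable {ψ : ℝ → ℝ} {p : ℝ → ℂ} {a : ℝ}

lemma norm_fourierKernel (q : ℝ × ℝ) (ξ : ℝ) :
    ‖fourierKernel ψ p q ξ‖ = ‖p ξ‖ * Real.exp (q.1 * ψ ξ) := by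
  simp [fourierKernel, Complex.norm_exp]

lemma continuous_fourierKernel (hψ : Continuous ψ) (hp : Continuous p) (q : ℝ × ℝ) :
    Continuous (fourierKernel ψ p q) := by
  unfold fourierKernel
  fun_prop

lemma exists_norm_fourierKernel_le (ha : 0 < a) (hψa : ∀ ξ, ψ ξ ≤ -a * ξ ^ 2)
    (hp : SubgaussianGrowth p) {δ : ℝ} (hδ : 0 < δ) :
    ∃ C, ∀ q : ℝ × ℝ, δ ≤ q.1 → ∀ ξ,
      ‖fourierKernel ψ p q ξ‖ ≤ C * Real.exp (-(δ * a / 2) * ξ ^ 2) := by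
  obtain ⟨C, hC⟩ := hp.2 (δ * a / 2) (by positivity)
  refine ⟨C, fun q hq ξ => ?_⟩
  have h : q.1 * ψ ξ ≤ -(δ * a) * ξ ^ 2 := by
    have h1 : q.1 * ψ ξ ≤ q.1 * (-a * ξ ^ 2) :=
      mul_le_mul_of_nonneg_left (hψa ξ) (hδ.le.trans hq)
    have h2 : δ * (a * ξ ^ 2) ≤ q.1 * (a * ξ ^ 2) :=
      mul_le_mul_of_nonneg_right hq (by positivity)
    linarith
  calc ‖fourierKernel ψ p q ξ‖ = ‖p ξ‖ * Real.exp (q.1 * ψ ξ) := norm_fourierKernel q ξ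
    _ ≤ (C * Real.exp (δ * a / 2 * ξ ^ 2)) * Real.exp (-(δ * a) * ξ ^ 2) :=
        mul_le_mul (hC ξ) (Real.exp_le_exp.2 h) (Real.exp_pos _).le
          ((norm_nonneg _).trans (hC ξ))
    _ = C * Real.exp (-(δ * a / 2) * ξ ^ 2) := by
        rw [mul_assoc, ← Real.exp_add]; ring_nf

lemma integrable_fourierKernel (ha : 0 < a) (hψ : Continuous ψ) (hψa : ∀ ξ, ψ ξ ≤ -a * ξ ^ 2)
    (hp : SubgaussianGrowth p) {q : ℝ × ℝ} (hq : 0 < q.1) :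
    Integrable (fourierKernel ψ p q) := by
  obtain ⟨C, hC⟩ := exists_norm_fourierKernel_le ha hψa hp hq
  exact ((integrable_exp_neg_mul_sq (by positivity)).const_mul C).mono'
    (continuous_fourierKernel hψ hp.1 q).aestronglyMeasurable (.of_forall (hC q le_rfl))

/-- The real-linear map `c ↦ (v ↦ c v.1)`. -/
noncomputable def fstSMulRight : ℂ →L[ℝ] (ℝ × ℝ →L[ℝ] ℂ) :=
  ContinuousLinearMap.smulRightL ℝ (ℝ × ℝ) ℂ (ContinuousLinearMap.fst ℝ ℝ ℝ)

/-- The real-linear map `c ↦ (v ↦ c v.2)`. -/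
noncomputable def sndSMulRight : ℂ →L[ℝ] (ℝ × ℝ →L[ℝ] ℂ) :=
  ContinuousLinearMap.smulRightL ℝ (ℝ × ℝ) ℂ (ContinuousLinearMap.snd ℝ ℝ ℝ)

lemma hasFDerivAt_fourierKernel (q : ℝ × ℝ) (ξ : ℝ) :
    HasFDerivAt (fun q => fourierKernel ψ p q ξ)
      (fstSMulRight (fourierKernel ψ (fun ξ => ψ ξ * p ξ) q ξ) +
        sndSMulRight (fourierKernel ψ (fun ξ => ξ * Complex.I * p ξ) q ξ)) q := by
  have h1 : HasFDerivAt (fun q : ℝ × ℝ => (q.1 : ℂ))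
      (Complex.ofRealCLM.comp (ContinuousLinearMap.fst ℝ ℝ ℝ)) q :=
    (Complex.ofRealCLM.comp (ContinuousLinearMap.fst ℝ ℝ ℝ)).hasFDerivAt
  have h2 : HasFDerivAt (fun q : ℝ × ℝ => (q.2 : ℂ))
      (Complex.ofRealCLM.comp (ContinuousLinearMap.snd ℝ ℝ ℝ)) q :=
    (Complex.ofRealCLM.comp (ContinuousLinearMap.snd ℝ ℝ ℝ)).hasFDerivAt
  have h := (((h1.mul_const (ψ ξ : ℂ)).add
    (h2.mul_const ((ξ : ℂ) * Complex.I))).cexp).const_mul (p ξ)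
  refine h.congr_fderiv ?_
  ext <;> simp [fstSMulRight, sndSMulRight, fourierKernel] <;> ring

theorem hasFDerivAt_integral_fourierKernel (ha : 0 < a) (hψ : SubgaussianGrowth (fun ξ => ψ ξ))
    (hψc : Continuous ψ) (hψa : ∀ ξ, ψ ξ ≤ -a * ξ ^ 2)
    (hp : SubgaussianGrowth p) {q : ℝ × ℝ} (hq : 0 < q.1) :
    HasFDerivAt (fun q => ∫ ξ, fourierKernel ψ p q ξ)
      (fstSMulRight (∫ ξ, fourierKernel ψ (fun ξ => ψ ξ * p ξ) q ξ) +
        sndSMulRight (∫ ξ, fourierKernel ψ (fun ξ => ξ * Complex.I * p ξ) q ξ)) q := by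
  have hδ : 0 < q.1 / 2 := half_pos hq
  have hp1 := hψ.mul hp
  have hp2 := SubgaussianGrowth.mul_I.mul hp
  obtain ⟨C, hC⟩ := exists_norm_fourierKernel_le ha hψa hp1 hδ
  obtain ⟨D, hD⟩ := exists_norm_fourierKernel_le ha hψa hp2 hδ
  have hi1 := integrable_fourierKernel ha hψc hψa hp1 hq
  have hi2 := integrable_fourierKernel ha hψc hψa hp2 hq
  have hint := integrable_exp_neg_mul_sq (b := q.1 / 2 * a / 2) (by positivity)
  have key := hasFDerivAt_integral_of_dominated_of_fderiv_le (𝕜 := ℝ) (μ := volume)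
    (F := fun q ξ => fourierKernel ψ p q ξ)
    (F' := fun q ξ => fstSMulRight (fourierKernel ψ (fun ξ => ψ ξ * p ξ) q ξ) +
        sndSMulRight (fourierKernel ψ (fun ξ => ξ * Complex.I * p ξ) q ξ))
    (bound := fun ξ => ‖fstSMulRight‖ * (C * Real.exp (-(q.1 / 2 * a / 2) * ξ ^ 2)) +
      ‖sndSMulRight‖ * (D * Real.exp (-(q.1 / 2 * a / 2) * ξ ^ 2)))
    (s := {r : ℝ × ℝ | q.1 / 2 < r.1}) (x₀ := q)
    ((isOpen_lt continuous_const continuous_fst).mem_nhds (by simp [hq]))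
    (.of_forall fun r => (continuous_fourierKernel hψc hp.1 r).aestronglyMeasurable)
    (integrable_fourierKernel ha hψc hψa hp hq)
    ((fstSMulRight.integrable_comp hi1).add (sndSMulRight.integrable_comp hi2)).1
    (.of_forall fun ξ r hr => (norm_add_le _ _).trans (add_le_add
      ((fstSMulRight.le_opNorm _).trans (by gcongr; exact hC r (le_of_lt hr) ξ))
      ((sndSMulRight.le_opNorm _).trans (by gcongr; exact hD r (le_of_lt hr) ξ))))
    (((hint.const_mul C).const_mul _).add ((hint.const_mul D).const_mul _))
    (.of_forall fun ξ r _ => hasFDerivAt_fourierKernel r ξ)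
  rwa [integral_add (fstSMulRight.integrable_comp hi1) (sndSMulRight.integrable_comp hi2),
    fstSMulRight.integral_comp_comm hi1, sndSMulRight.integral_comp_comm hi2] at key

theorem contDiffOn_integral_fourierKernel (ha : 0 < a) (hψ : SubgaussianGrowth (fun ξ => ψ ξ))
    (hψc : Continuous ψ) (hψa : ∀ ξ, ψ ξ ≤ -a * ξ ^ 2) (hp : SubgaussianGrowth p) :
    ContDiffOn ℝ (⊤ : ℕ∞) (fun q => ∫ ξ, fourierKernel ψ p q ξ)
      (Set.Ioi (0 : ℝ) ×ˢ (Set.univ : Set ℝ)) := by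
  have hs : IsOpen (Set.Ioi (0 : ℝ) ×ˢ (Set.univ : Set ℝ)) := isOpen_Ioi.prod isOpen_univ
  refine contDiffOn_infty.2 fun n => ?_
  induction n generalizing p with
  | zero =>
    exact contDiffOn_zero.2 fun q hq =>
      (hasFDerivAt_integral_fourierKernel ha hψ hψc hψa hp hq.1).continuousAt.continuousWithinAt
  | succ n ih =>
    push_cast
    refine (contDiffOn_succ_iff_hasFDerivWithinAt_of_uniqueDiffOn hs.uniqueDiffOn).2
      ⟨fun h => absurd h (by simp), _, ?_, fun q hq =>
        (hasFDerivAt_integral_fourierKernel ha hψ hψc hψa hp hq.1).hasFDerivWithinAt⟩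
    exact (fstSMulRight.contDiff.comp_contDiffOn (ih (hψ.mul hp))).add
      (sndSMulRight.contDiff.comp_contDiffOn (ih (SubgaussianGrowth.mul_I.mul hp)))

lemma hasDerivAt_fst_integral_fourierKernel (ha : 0 < a)
    (hψ : SubgaussianGrowth (fun ξ => ψ ξ)) (hψc : Continuous ψ)
    (hψa : ∀ ξ, ψ ξ ≤ -a * ξ ^ 2) (hp : SubgaussianGrowth p) {t : ℝ} (ht : 0 < t) (x : ℝ) :
    HasDerivAt (fun s => ∫ ξ, fourierKernel ψ p (s, x) ξ)
      (∫ ξ, fourierKernel ψ (fun ξ => ψ ξ * p ξ) (t, x) ξ) t := by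
  have h := (hasFDerivAt_integral_fourierKernel ha hψ hψc hψa hp (q := (t, x)) ht).comp_hasDerivAt
    t ((hasDerivAt_id t).prodMk (hasDerivAt_const t x))
  simpa [fstSMulRight, sndSMulRight, Function.comp_def] using h

lemma hasDerivAt_snd_integral_fourierKernel (ha : 0 < a)
    (hψ : SubgaussianGrowth (fun ξ => ψ ξ)) (hψc : Continuous ψ)
    (hψa : ∀ ξ, ψ ξ ≤ -a * ξ ^ 2) (hp : SubgaussianGrowth p) {t : ℝ} (ht : 0 < t) (x : ℝ) :
    HasDerivAt (fun y => ∫ ξ, fourierKernel ψ p (t, y) ξ)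
      (∫ ξ, fourierKernel ψ (fun ξ => ξ * Complex.I * p ξ) (t, x) ξ) x := by
  have h := (hasFDerivAt_integral_fourierKernel ha hψ hψc hψa hp (q := (t, x)) ht).comp_hasDerivAt
    x ((hasDerivAt_const x t).prodMk (hasDerivAt_id x))
  simpa [fstSMulRight, sndSMulRight, Function.comp_def] using h

end FourierKernel

/-- The Fourier transform of a centred Gaussian. -/
lemma integral_cexp_mul_gaussian {s : ℝ} (hs : 0 < s) (x : ℝ) :
    ∫ ξ : ℝ, Complex.exp (x * (ξ * Complex.I)) * (Real.exp (-(s / 2) * ξ ^ 2) : ℂ) =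
      ((√(2 * π / s) * Real.exp (-x ^ 2 / (2 * s)) : ℝ) : ℂ) := by
  have h := fourierIntegral_gaussian (b := ((s / 2 : ℝ) : ℂ))
    (by rw [Complex.ofReal_re]; positivity) (x : ℂ)
  have h2 : ((π : ℂ) / ((s / 2 : ℝ) : ℂ)) ^ (1 / 2 : ℂ) = (√(2 * π / s) : ℝ) := by
    rw [Real.sqrt_eq_rpow, Complex.ofReal_cpow (by positivity)]
    congr 1
    · push_cast
      field_simp
    · simp
  rw [h2] at h
  rw [Complex.ofReal_mul]
  convert h using 1
  · congr 1
    ext ξ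
    push_cast
    ring_nf
  · push_cast
    congr 3
    ring

/-- The Lévy–Khintchine symbol `-αξ²/2 + ℓ (exp (-θξ²/2) - 1)` of the jump-diffusion. -/
noncomputable def jumpSymbol (α θ l ξ : ℝ) : ℝ :=
  -(α / 2) * ξ ^ 2 + l * (Real.exp (-(θ / 2) * ξ ^ 2) - 1)

section JumpSymbol

variable {α θ l : ℝ}

lemma continuous_jumpSymbol : Continuous (jumpSymbol α θ l) := by
  unfold jumpSymbol
  fun_prop

lemma exp_neg_mul_sq_le_one (hθ : 0 < θ) (ξ : ℝ) : Real.exp (-(θ / 2) * ξ ^ 2) ≤ 1 :=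
  Real.exp_le_one_iff.2 (by nlinarith [mul_nonneg hθ.le (sq_nonneg ξ)])

lemma jumpSymbol_le (hθ : 0 < θ) (hl : 0 ≤ l) (ξ : ℝ) :
    jumpSymbol α θ l ξ ≤ -(α / 2) * ξ ^ 2 := by
  have := mul_nonneg hl (sub_nonneg.2 (exp_neg_mul_sq_le_one hθ ξ))
  unfold jumpSymbol
  linarith

lemma subgaussianGrowth_jumpSymbol (hα : 0 < α) (hθ : 0 < θ) (hl : 0 ≤ l) :
    SubgaussianGrowth (fun ξ => jumpSymbol α θ l ξ) := by
  refine .of_le_sq (Complex.continuous_ofReal.comp continuous_jumpSymbol)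
    (A := l) (B := α / 2) (by positivity) hl fun ξ => ?_
  rw [Complex.norm_real, Real.norm_eq_abs, abs_le]
  have h1 := jumpSymbol_le (α := α) hθ hl ξ
  have h2 := mul_nonneg hl (Real.exp_pos (-(θ / 2) * ξ ^ 2)).le
  have h3 : 0 ≤ α / 2 * ξ ^ 2 := by positivity
  refine ⟨?_, by linarith⟩
  unfold jumpSymbol
  linarith

lemma inv_sqrt_two_pi_mul {s : ℝ} (hs : 0 < s) : (√(2 * π * s))⁻¹ = (2 * π)⁻¹ * √(2 * π / s) := by
  have hp : 0 < 2 * π := by positivity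
  rw [Real.sqrt_mul hp.le, Real.sqrt_div hp.le]
  have h := Real.mul_self_sqrt hp.le
  have h1 := Real.sqrt_pos.2 hp
  have h2 := Real.sqrt_pos.2 hs
  field_simp
  rw [sq, h]

lemma GBn_eq_integral {t : ℝ} (hα : 0 < α) (hθ : 0 < θ) (ht : 0 < t) (n : ℕ) (x : ℝ) :
    (GBn α θ n t x : ℂ) = (2 * π : ℂ)⁻¹ * ∫ ξ : ℝ, Complex.exp (x * (ξ * Complex.I)) *
      (Real.exp (-((α * t + n * θ) / 2) * ξ ^ 2) : ℂ) := by
  have hs : 0 < α * t + n * θ := by positivity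
  rw [integral_cexp_mul_gaussian hs, GBn, inv_sqrt_two_pi_mul hs]
  push_cast
  ring

lemma hasSum_poisson_exp (c y : ℝ) :
    HasSum (fun n : ℕ => c ^ n / (n.factorial : ℝ) * Real.exp (n * y))
      (Real.exp (c * Real.exp y)) := by
  have h := NormedSpace.expSeries_div_hasSum_exp (c * Real.exp y)
  rw [← Real.exp_eq_exp_ℝ] at h
  refine h.congr_fun fun n => ?_
  rw [mul_pow, Real.exp_nat_mul]
  ring

/-- Fourier representation of `Γ̄^{α,θ,ℓ}`. -/
theorem GB_eq_integral (hα : 0 < α) (hθ : 0 < θ) (hl : 0 ≤ l) {t : ℝ} (ht : 0 < t) (x : ℝ) :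
    (GB α θ l t x : ℂ) =
      (2 * π : ℂ)⁻¹ * ∫ ξ, fourierKernel (jumpSymbol α θ l) (fun _ => 1) (t, x) ξ := by
  have hlt : 0 ≤ l * t := by positivity
  let F : ℕ → ℝ → ℂ := fun n ξ => (((l * t) ^ n / (n.factorial : ℝ) : ℝ) : ℂ) *
    (Complex.exp (x * (ξ * Complex.I)) * (Real.exp (-((α * t + n * θ) / 2) * ξ ^ 2) : ℂ))
  let b : ℕ → ℝ → ℝ := fun n ξ => (l * t) ^ n / (n.factorial : ℝ) *
    Real.exp (-(α * t / 2) * ξ ^ 2)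
  have hc : Summable fun n : ℕ => (l * t) ^ n / (n.factorial : ℝ) :=
    Real.summable_pow_div_factorial _
  have key : HasSum (fun n => ∫ ξ, F n ξ) (∫ ξ : ℝ, (Real.exp (l * t) : ℂ) *
      fourierKernel (jumpSymbol α θ l) (fun _ => 1) (t, x) ξ) := by
    refine hasSum_integral_of_dominated_convergence b (fun n => ?_) (fun n => .of_forall fun ξ => ?_)
      (.of_forall fun ξ => hc.mul_right _) ?_ (.of_forall fun ξ => ?_)
    · exact Continuous.aestronglyMeasurable (by fun_prop)
    · have h0 : ‖Complex.exp (x * (ξ * Complex.I))‖ = 1 := by simp [Complex.norm_exp]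
      have h1 : 0 ≤ (l * t) ^ n / (n.factorial : ℝ) := by positivity
      simp only [F, b, norm_mul, h0, one_mul, Complex.norm_real, Real.norm_eq_abs, Real.abs_exp,
        abs_of_nonneg h1]
      refine mul_le_mul_of_nonneg_left (Real.exp_le_exp.2 ?_) h1
      have : 0 ≤ n * θ * ξ ^ 2 := by positivity
      linarith
    · simp only [b, tsum_mul_right]
      exact (integrable_exp_neg_mul_sq (by positivity)).const_mul _
    · have h := (Complex.hasSum_ofReal.2 (hasSum_poisson_exp (l * t) (-(θ / 2) * ξ ^ 2))).mul_left
        (Complex.exp (x * (ξ * Complex.I)) * (Real.exp (-(α * t / 2) * ξ ^ 2) : ℂ))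
      have hv : (Real.exp (l * t) : ℂ) * fourierKernel (jumpSymbol α θ l) (fun _ => 1) (t, x) ξ =
          Complex.exp (x * (ξ * Complex.I)) * (Real.exp (-(α * t / 2) * ξ ^ 2) : ℂ) *
            (Real.exp (l * t * Real.exp (-(θ / 2) * ξ ^ 2)) : ℂ) := by
        simp only [fourierKernel, jumpSymbol]
        push_cast
        simp only [one_mul, ← Complex.exp_add]
        ring_nf
      rw [hv]
      refine h.congr_fun fun n => ?_
      have : Real.exp (-((α * t + n * θ) / 2) * ξ ^ 2) = Real.exp (-(α * t / 2) * ξ ^ 2) *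
          Real.exp (n * (-(θ / 2) * ξ ^ 2)) := by
        rw [← Real.exp_add]
        ring_nf
      simp only [F, this]
      push_cast
      ring
  have hsum := key.mul_left ((2 * π : ℂ)⁻¹)
  have hterm : ∀ n, (2 * π : ℂ)⁻¹ * ∫ ξ, F n ξ =
      (((l * t) ^ n / (n.factorial : ℝ) * GBn α θ n t x : ℝ) : ℂ) := fun n => by
    rw [Complex.ofReal_mul, GBn_eq_integral hα hθ ht]
    simp only [F]
    rw [integral_const_mul]
    ring
  simp only [hterm] at hsum
  rw [GB, Complex.ofReal_mul, Complex.ofReal_tsum, hsum.tsum_eq, integral_const_mul,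
    mul_left_comm, ← mul_assoc (Real.exp (-(l * t)) : ℂ), ← Complex.ofReal_mul, ← Real.exp_add]
  simp

/-- The normalised Gaussian jump law has characteristic function `exp (-θξ²/2)`. -/
lemma integral_cexp_sub_one_mul_gaussian (hθ : 0 < θ) (ξ : ℝ) :
    ∫ z : ℝ, (Complex.exp (ξ * (z * Complex.I)) - 1) *
        (((√(2 * π * θ))⁻¹ * Real.exp (-z ^ 2 / (2 * θ)) : ℝ) : ℂ) =
      ((Real.exp (-(θ / 2) * ξ ^ 2) - 1 : ℝ) : ℂ) := by
  have hg : ∀ z : ℝ, -z ^ 2 / (2 * θ) = -(θ⁻¹ / 2) * z ^ 2 := fun z => by field_simp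
  have hi : Integrable fun z : ℝ => Real.exp (-(θ⁻¹ / 2) * z ^ 2) :=
    integrable_exp_neg_mul_sq (by positivity)
  have hi' : ∀ y : ℝ, Integrable fun z : ℝ =>
      Complex.exp (y * (z * Complex.I)) * (Real.exp (-(θ⁻¹ / 2) * z ^ 2) : ℂ) := fun y =>
    hi.mono' (Continuous.aestronglyMeasurable (by fun_prop))
      (.of_forall fun z => by
        rw [norm_mul, Complex.norm_real, Real.norm_eq_abs, Real.abs_exp]
        simp [Complex.norm_exp])
  have hF := fun y : ℝ => integral_cexp_mul_gaussian (inv_pos.2 hθ) y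
  have hs : (√(2 * π * θ)) ≠ 0 := by positivity
  calc _ = ∫ z : ℝ, (((√(2 * π * θ))⁻¹ : ℝ) : ℂ) *
        (Complex.exp (ξ * (z * Complex.I)) * (Real.exp (-(θ⁻¹ / 2) * z ^ 2) : ℂ) -
          Complex.exp ((0 : ℝ) * (z * Complex.I)) * (Real.exp (-(θ⁻¹ / 2) * z ^ 2) : ℂ)) := by
        congr 1
        ext z
        rw [hg]
        push_cast
        simp only [zero_mul, Complex.exp_zero]
        ring
    _ = _ := by
        rw [integral_const_mul, integral_sub (hi' ξ) (hi' 0), hF, hF, ← Complex.ofReal_sub,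
          ← Complex.ofReal_mul, ← mul_sub, div_inv_eq_mul, inv_mul_cancel_left₀ hs]
        congr 2
        · congr 1
          field_simp
        · simp

/-- The jump operator acts on Fourier integrals by multiplying the integrand by its symbol. -/
theorem integral_jump_fourierKernel {ψ : ℝ → ℝ} {a t : ℝ} (ha : 0 < a) (hψ : Continuous ψ)
    (hψa : ∀ ξ, ψ ξ ≤ -a * ξ ^ 2) (hθ : 0 < θ) (ht : 0 < t) (x : ℝ) :
    ∫ z : ℝ, ((∫ ξ, fourierKernel ψ (fun _ => 1) (t, x + z) ξ) -
        ∫ ξ, fourierKernel ψ (fun _ => 1) (t, x) ξ) *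
          (((√(2 * π * θ))⁻¹ * Real.exp (-z ^ 2 / (2 * θ)) : ℝ) : ℂ) =
      ∫ ξ, fourierKernel ψ (fun ξ => ((Real.exp (-(θ / 2) * ξ ^ 2) - 1 : ℝ) : ℂ)) (t, x) ξ := by
  have hK := fun y : ℝ => integrable_fourierKernel ha hψ hψa .one (q := (t, y)) ht
  have hg : Integrable fun z : ℝ => (√(2 * π * θ))⁻¹ * Real.exp (-z ^ 2 / (2 * θ)) := by
    have := (integrable_exp_neg_mul_sq (b := θ⁻¹ / 2) (by positivity)).const_mul (√(2 * π * θ))⁻¹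
    refine this.congr (.of_forall fun z => ?_)
    simp only
    congr 2
    field_simp
  have hswap : Integrable (Function.uncurry fun z ξ : ℝ =>
      fourierKernel ψ (fun _ => 1) (t, x) ξ * ((Complex.exp (ξ * (z * Complex.I)) - 1) *
        (((√(2 * π * θ))⁻¹ * Real.exp (-z ^ 2 / (2 * θ)) : ℝ) : ℂ)))
      (volume.prod volume) := by
    refine ((hg.norm.const_mul 2).mul_prod (hK x).norm).mono' ?_ (.of_forall fun w => ?_)
    · have := continuous_fourierKernel hψ SubgaussianGrowth.one.1 (t, x)
      refine Continuous.aestronglyMeasurable ?_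
      unfold Function.uncurry
      fun_prop
    · have h2 : ‖Complex.exp (w.2 * (w.1 * Complex.I)) - 1‖ ≤ 2 := by
        refine (norm_sub_le _ _).trans_eq ?_
        simp [Complex.norm_exp]
        norm_num
      rw [Function.uncurry, norm_mul, norm_mul, Complex.norm_real, mul_comm]
      gcongr
  calc _ = ∫ z : ℝ, ∫ ξ : ℝ, fourierKernel ψ (fun _ => 1) (t, x) ξ *
        ((Complex.exp (ξ * (z * Complex.I)) - 1) *
          (((√(2 * π * θ))⁻¹ * Real.exp (-z ^ 2 / (2 * θ)) : ℝ) : ℂ)) := by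
        congr 1
        ext z
        rw [← integral_sub (hK _) (hK _), ← integral_mul_const]
        congr 1
        ext ξ
        have : fourierKernel ψ (fun _ => 1) (t, x + z) ξ =
            fourierKernel ψ (fun _ => 1) (t, x) ξ * Complex.exp (ξ * (z * Complex.I)) := by
          simp only [fourierKernel, one_mul, ← Complex.exp_add]
          push_cast
          ring_nf
        rw [this]
        ring
    _ = _ := by
        rw [integral_integral_swap hswap]
        congr 1
        ext ξ
        rw [integral_const_mul, integral_cexp_sub_one_mul_gaussian hθ]
        simp only [fourierKernel]
        ring

end JumpSymbol

/-- `Γ̄^{α,θ,ℓ}` is smooth on `(0,∞) × ℝ` and solves the Kolmogorov equation of the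
constant-coefficient jump-diffusion operator `L̄^{α,θ,ℓ}`. -/
theorem stmt9 (α θ l : ℝ) (hα : 0 < α) (hθ : 0 < θ) (hl : 0 ≤ l) :
    ContDiffOn ℝ (⊤ : ℕ∞) (fun p : ℝ × ℝ => GB α θ l p.1 p.2)
      (Set.Ioi (0 : ℝ) ×ˢ (Set.univ : Set ℝ)) ∧
    ∀ t : ℝ, 0 < t → ∀ x : ℝ,
      deriv (fun s => GB α θ l s x) t =
        α / 2 * deriv (deriv (fun w => GB α θ l t w)) x
          + l * ∫ z : ℝ, (GB α θ l t (x + z) - GB α θ l t x) *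
              ((Real.sqrt (2 * Real.pi * θ))⁻¹ * Real.exp (-z ^ 2 / (2 * θ))) := by

  set ψ := jumpSymbol α θ l with hψdef
  have ha : 0 < α / 2 := half_pos hα
  have hψ : SubgaussianGrowth (fun ξ => ψ ξ) := subgaussianGrowth_jumpSymbol hα hθ hl
  have hψc : Continuous ψ := continuous_jumpSymbol
  have hψa : ∀ ξ, ψ ξ ≤ -(α / 2) * ξ ^ 2 := jumpSymbol_le hθ hl
  set J : (ℝ → ℂ) → ℝ → ℝ → ℂ := fun p t x =>
    (2 * π : ℂ)⁻¹ * ∫ ξ, fourierKernel ψ p (t, x) ξ with hJ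
  have hrep : ∀ t, 0 < t → ∀ x, (GB α θ l t x : ℂ) = J (fun _ => 1) t x :=
    fun t ht x => GB_eq_integral hα hθ hl ht x
  have hre : ∀ t, 0 < t → ∀ x, GB α θ l t x = (J (fun _ => 1) t x).re := fun t ht x => by
    rw [← hrep t ht x, Complex.ofReal_re]
  refine ⟨?_, fun t ht x => ?_⟩
  · have h := Complex.reCLM.contDiff.comp_contDiffOn ((contDiffOn_const (c := (2 * π : ℂ)⁻¹)).mul
      (contDiffOn_integral_fourierKernel ha hψ hψc hψa .one))
    exact h.congr fun q hq => hre q.1 hq.1 q.2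
  have hre_deriv : ∀ {f : ℝ → ℂ} {f' : ℂ} {y : ℝ}, HasDerivAt f f' y →
      HasDerivAt (fun y => (f y).re) f'.re y := fun h =>
    Complex.reCLM.hasFDerivAt.comp_hasDerivAt _ h
  have hx : ∀ {p : ℝ → ℂ}, SubgaussianGrowth p → ∀ y,
      HasDerivAt (fun y => (J p t y).re) (J (fun ξ => ξ * Complex.I * p ξ) t y).re y :=
    fun hp y => hre_deriv
      ((hasDerivAt_snd_integral_fourierKernel ha hψ hψc hψa hp ht y).const_mul _)
  have hdt : deriv (fun s => GB α θ l s x) t = (J (fun ξ => ψ ξ * 1) t x).re := by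
    refine HasDerivAt.deriv ((hre_deriv ((hasDerivAt_fst_integral_fourierKernel ha hψ hψc hψa
      .one ht x).const_mul ((2 * π : ℂ)⁻¹))).congr_of_eventuallyEq ?_)
    filter_upwards [lt_mem_nhds ht] with s hs using hre s hs x
  have hdx : deriv (deriv fun w => GB α θ l t w) x =
      (J (fun ξ => ξ * Complex.I * (ξ * Complex.I * 1)) t x).re := by
    have h1 : (fun w => GB α θ l t w) = fun w => (J (fun _ => 1) t w).re := funext (hre t ht)
    have h2 : deriv (fun w => GB α θ l t w) =
        fun w => (J (fun ξ => ξ * Complex.I * 1) t w).re := by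
      rw [h1]
      exact funext fun w => (hx .one w).deriv
    rw [h2]
    exact (hx (SubgaussianGrowth.mul_I.mul .one) x).deriv
  have hjump : ∫ z : ℝ, (GB α θ l t (x + z) - GB α θ l t x) *
      ((√(2 * π * θ))⁻¹ * Real.exp (-z ^ 2 / (2 * θ))) =
      (J (fun ξ => ((Real.exp (-(θ / 2) * ξ ^ 2) - 1 : ℝ) : ℂ)) t x).re := by
    rw [← Complex.ofReal_re (∫ z : ℝ, _), ← integral_complex_ofReal]
    congr 1
    simp only [hJ]
    rw [← integral_jump_fourierKernel ha hψc hψa hθ ht, ← integral_const_mul]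
    congr 1
    ext z
    rw [Complex.ofReal_mul, Complex.ofReal_sub, hrep t ht, hrep t ht]
    simp only [hJ]
    ring
  have hgE : SubgaussianGrowth (fun ξ => ((Real.exp (-(θ / 2) * ξ ^ 2) - 1 : ℝ) : ℂ)) := by
    refine .of_le_sq (by fun_prop) (A := 1) (B := 0) le_rfl zero_le_one fun ξ => ?_
    rw [Complex.norm_real, Real.norm_eq_abs, abs_le]
    constructor <;>
      linarith [Real.exp_pos (-(θ / 2) * ξ ^ 2), exp_neg_mul_sq_le_one hθ ξ]
  have hi1 := integrable_fourierKernel ha hψc hψa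
    (SubgaussianGrowth.mul_I.mul (SubgaussianGrowth.mul_I.mul .one)) (q := (t, x)) ht
  have hi2 := integrable_fourierKernel ha hψc hψa hgE (q := (t, x)) ht
  have hsymbol : J (fun ξ => ψ ξ * 1) t x =
      (α / 2 : ℝ) * J (fun ξ => ξ * Complex.I * (ξ * Complex.I * 1)) t x +
        l * J (fun ξ => ((Real.exp (-(θ / 2) * ξ ^ 2) - 1 : ℝ) : ℂ)) t x := by
    simp only [hJ]
    rw [mul_left_comm, mul_left_comm (l : ℂ), ← mul_add, ← integral_const_mul ((α / 2 : ℝ) : ℂ),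
      ← integral_const_mul (l : ℂ), ← integral_add (hi1.const_mul _) (hi2.const_mul _)]
    congr 2
    ext ξ
    simp only [fourierKernel, hψdef, jumpSymbol]
    push_cast
    linear_combination (-(α / 2 : ℂ) * ξ ^ 2 * Complex.exp (t * (-(α / 2) * ξ ^ 2 +
      l * (Complex.exp (-(θ / 2) * ξ ^ 2) - 1)) + x * (ξ * Complex.I))) * Complex.I_sq
  rw [hdt, hdx, hjump, hsymbol, Complex.add_re, Complex.re_ofReal_mul, Complex.re_ofReal_mul]
end

section
/- (Symmetry property of the leading-order density: multiplication by the forward variable equals an explicit integro-differential operator in the backward variable.) For all real α, θ > 0, ℓ ≥ 0, every s > 0 and all x, y ∈ ℝ, one has y · Γ^{α,θ,ℓ}(s, x−y) = ( x − (α/2 + ℓ(e^{θ/2}−1)) s ) · Γ^{α,θ,ℓ}(s, x−y) + α s · (∂_w Γ^{α,θ,ℓ}(s, ·))(x−y) + ℓ θ s · (∂_w (𝒞_θ Γ^{α,θ,ℓ}(s,·)))(x−y), where ∂_w denotes the derivative in the spatial variable. -/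
open Real MeasureTheory

/-- The centered Gaussian density with variance `v`. -/
noncomputable def centeredGaussian (v u : ℝ) : ℝ :=
  (Real.sqrt (2 * Real.pi * v))⁻¹ * Real.exp (-u ^ 2 / (2 * v))

theorem centeredGaussian_nonneg (v u : ℝ) : 0 ≤ centeredGaussian v u := by
  unfold centeredGaussian; positivity

theorem hasDerivAt_centeredGaussian (v u : ℝ) :
    HasDerivAt (centeredGaussian v) (-(u / v) * centeredGaussian v u) u := by
  have h : HasDerivAt (fun u : ℝ => -u ^ 2 / (2 * v)) (-(u / v)) u := by
    refine (((hasDerivAt_id u).pow 2).neg.div_const (2 * v)).congr_deriv ?_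
    simp only [id, Nat.cast_ofNat, Nat.add_one_sub_one, pow_one, mul_one]
    rw [neg_div, mul_div_mul_left _ _ two_ne_zero]
  refine (h.exp.const_mul (Real.sqrt (2 * Real.pi * v))⁻¹).congr_deriv ?_
  unfold centeredGaussian
  ring

theorem inv_sqrt_two_pi_mul_le {v₀ v : ℝ} (h₀ : 0 < v₀) (h : v₀ ≤ v) :
    (Real.sqrt (2 * Real.pi * v))⁻¹ ≤ (Real.sqrt (2 * Real.pi * v₀))⁻¹ := by
  gcongr

theorem centeredGaussian_le {v₀ v : ℝ} (h₀ : 0 < v₀) (h : v₀ ≤ v) (u : ℝ) :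
    centeredGaussian v u ≤ (Real.sqrt (2 * Real.pi * v₀))⁻¹ := by
  have hv : 0 < v := h₀.trans_le h
  refine (mul_le_of_le_one_right (by positivity) ?_).trans (inv_sqrt_two_pi_mul_le h₀ h)
  rw [Real.exp_le_one_iff, neg_div]
  exact neg_nonpos.2 (by positivity)

theorem abs_deriv_centeredGaussian_le {v₀ v : ℝ} (h₀ : 0 < v₀) (h : v₀ ≤ v) (u : ℝ) :
    |(-(u / v) * centeredGaussian v u)| ≤ (1 + 1 / v₀) * (Real.sqrt (2 * Real.pi * v₀))⁻¹ := by
  have hv : 0 < v := h₀.trans_le h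
  rw [abs_mul, abs_neg, abs_of_nonneg (centeredGaussian_nonneg v u), abs_div, abs_of_pos hv]
  have hq : |u| / v ≤ (1 + 1 / v₀) * Real.exp (u ^ 2 / (2 * v)) := by
    have hinv : 1 / v ≤ 1 / v₀ := one_div_le_one_div_of_le h₀ h
    have hamgm : |u| / v ≤ 1 / v / 2 + u ^ 2 / (2 * v) := by
      have : 1 / v / 2 + u ^ 2 / (2 * v) - |u| / v = (1 - |u|) ^ 2 / (2 * v) := by
        rw [← sq_abs u]; field_simp; ring
      have : 0 ≤ (1 - |u|) ^ 2 / (2 * v) := by positivity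
      linarith
    have hexp := Real.add_one_le_exp (u ^ 2 / (2 * v))
    have hu : 0 ≤ u ^ 2 / (2 * v) := by positivity
    have hv₀ : 0 < 1 / v₀ := by positivity
    nlinarith [mul_nonneg hv₀.le hu]
  calc |u| / v * centeredGaussian v u
      ≤ (1 + 1 / v₀) * Real.exp (u ^ 2 / (2 * v)) * centeredGaussian v u :=
        mul_le_mul_of_nonneg_right hq (centeredGaussian_nonneg v u)
    _ = (1 + 1 / v₀) * (Real.sqrt (2 * Real.pi * v))⁻¹ := by
        rw [centeredGaussian, neg_div, Real.exp_neg]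
        field_simp
    _ ≤ _ := mul_le_mul_of_nonneg_left (inv_sqrt_two_pi_mul_le h₀ h) (by positivity)

theorem centeredGaussian_add_mul {v θ : ℝ} (hv : 0 < v) (hθ : 0 < θ) (x z : ℝ) :
    centeredGaussian v (x + z) * centeredGaussian θ z =
      centeredGaussian (v + θ) x *
        ProbabilityTheory.gaussianPDFReal (-(θ * x) / (v + θ)) (v * θ / (v + θ)).toNNReal z := by
  have hpos : 0 < v * θ / (v + θ) := by positivity
  have hsqrt : Real.sqrt (2 * Real.pi * v) * Real.sqrt (2 * Real.pi * θ) =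
      Real.sqrt (2 * Real.pi * (v + θ)) * Real.sqrt (2 * Real.pi * (v * θ / (v + θ))) := by
    rw [← Real.sqrt_mul (by positivity), ← Real.sqrt_mul (by positivity)]
    congr 1
    field_simp
  have hexp : -(x + z) ^ 2 / (2 * v) + -z ^ 2 / (2 * θ) =
      -x ^ 2 / (2 * (v + θ)) +
        -(z - -(θ * x) / (v + θ)) ^ 2 / (2 * (v * θ / (v + θ))) := by
    field_simp
    ring
  unfold centeredGaussian ProbabilityTheory.gaussianPDFReal
  rw [Real.coe_toNNReal _ hpos.le, mul_mul_mul_comm, ← mul_inv, hsqrt,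
    ← Real.exp_add, hexp, mul_inv, Real.exp_add, mul_mul_mul_comm]

theorem integrable_centeredGaussian_add_mul {v θ : ℝ} (hv : 0 < v) (hθ : 0 < θ) (x : ℝ) :
    Integrable fun z => centeredGaussian v (x + z) * centeredGaussian θ z := by
  simp_rw [centeredGaussian_add_mul hv hθ]
  exact (ProbabilityTheory.integrable_gaussianPDFReal _ _).const_mul _

theorem integral_centeredGaussian_add_mul {v θ : ℝ} (hv : 0 < v) (hθ : 0 < θ) (x : ℝ) :
    ∫ z, centeredGaussian v (x + z) * centeredGaussian θ z = centeredGaussian (v + θ) x := by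
  have hpos : 0 < v * θ / (v + θ) := by positivity
  simp_rw [centeredGaussian_add_mul hv hθ]
  rw [integral_const_mul, ProbabilityTheory.integral_gaussianPDFReal_eq_one, mul_one]
  exact (Real.toNNReal_pos.2 hpos).ne'

theorem summable_mixture {p v : ℕ → ℝ} {v₀ : ℝ} (hp : Summable p) (hp₀ : ∀ n, 0 ≤ p n)
    (h₀ : 0 < v₀) (hv : ∀ n, v₀ ≤ v n) (u : ℝ) :
    Summable fun n => p n * centeredGaussian (v n) u :=
  (hp.mul_right _).of_nonneg_of_le
    (fun n => mul_nonneg (hp₀ n) (centeredGaussian_nonneg _ _))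
    fun n => mul_le_mul_of_nonneg_left (centeredGaussian_le h₀ (hv n) u) (hp₀ n)

theorem summable_deriv_mixture {p v : ℕ → ℝ} {v₀ : ℝ} (hp : Summable p) (hp₀ : ∀ n, 0 ≤ p n)
    (h₀ : 0 < v₀) (hv : ∀ n, v₀ ≤ v n) (u : ℝ) :
    Summable fun n => p n * (-(u / v n) * centeredGaussian (v n) u) := by
  refine (hp.mul_right ((1 + 1 / v₀) * (Real.sqrt (2 * Real.pi * v₀))⁻¹)).of_norm_bounded
    fun n => ?_
  rw [norm_mul, Real.norm_of_nonneg (hp₀ n)]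
  exact mul_le_mul_of_nonneg_left (abs_deriv_centeredGaussian_le h₀ (hv n) u) (hp₀ n)

theorem hasDerivAt_mixture {p v : ℕ → ℝ} {v₀ : ℝ} (hp : Summable p) (hp₀ : ∀ n, 0 ≤ p n)
    (h₀ : 0 < v₀) (hv : ∀ n, v₀ ≤ v n) (u : ℝ) :
    HasDerivAt (fun u => ∑' n, p n * centeredGaussian (v n) u)
      (∑' n, p n * (-(u / v n) * centeredGaussian (v n) u)) u := by
  refine hasDerivAt_tsum (hp.mul_right ((1 + 1 / v₀) * (Real.sqrt (2 * Real.pi * v₀))⁻¹))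
    (fun n y => (hasDerivAt_centeredGaussian (v n) y).const_mul (p n)) (fun n y => ?_)
    (summable_mixture hp hp₀ h₀ hv u) u
  rw [norm_mul, Real.norm_of_nonneg (hp₀ n)]
  exact mul_le_mul_of_nonneg_left (abs_deriv_centeredGaussian_le h₀ (hv n) y) (hp₀ n)

theorem conv_mixture {p v : ℕ → ℝ} {v₀ θ : ℝ} (hp : Summable p) (hp₀ : ∀ n, 0 ≤ p n)
    (h₀ : 0 < v₀) (hv : ∀ n, v₀ ≤ v n) (hθ : 0 < θ) (m x : ℝ) :
    conv θ (fun w => ∑' n, p n * centeredGaussian (v n) (w - m)) x =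
      ∑' n, p n * centeredGaussian (v n + θ) (x - m) := by
  let F : ℕ → ℝ → ℝ := fun n z =>
    p n * (centeredGaussian (v n) ((x - m) + z) * centeredGaussian θ z)
  have hF₀ : ∀ n z, 0 ≤ F n z := fun n z => mul_nonneg (hp₀ n)
    (mul_nonneg (centeredGaussian_nonneg _ _) (centeredGaussian_nonneg _ _))
  have hFint : ∀ n, Integrable (F n) := fun n =>
    (integrable_centeredGaussian_add_mul (h₀.trans_le (hv n)) hθ _).const_mul _
  have hF : ∀ n, ∫ z, F n z = p n * centeredGaussian (v n + θ) (x - m) := fun n => by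
    rw [integral_const_mul, integral_centeredGaussian_add_mul (h₀.trans_le (hv n)) hθ]
  have hsum : Summable fun n => ∫ z, ‖F n z‖ := by
    simp_rw [Real.norm_of_nonneg (hF₀ _ _), hF]
    exact summable_mixture hp hp₀ h₀ (fun n => (hv n).trans (le_add_of_nonneg_right hθ.le)) _
  have h := (hasSum_integral_of_summable_integral_norm hFint hsum).tsum_eq
  simp_rw [hF] at h
  rw [h, conv]
  congr 1 with z
  rw [← tsum_mul_right]
  refine tsum_congr fun n => ?_
  change _ * centeredGaussian θ z = _
  simp only [F]
  rw [show x + z - m = x - m + z by ring, mul_assoc]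

/-- Symmetry property of the leading-order density: multiplication by the forward variable
equals an explicit integro-differential operator in the backward variable. -/
theorem stmt11 (α θ l : ℝ) (hα : 0 < α) (hθ : 0 < θ) (hl : 0 ≤ l)
    (s : ℝ) (hs : 0 < s) (x y : ℝ) :
    y * G α θ l s (x - y) =
      (x - (α / 2 + l * (Real.exp (θ / 2) - 1)) * s) * G α θ l s (x - y)
        + α * s * deriv (fun w => G α θ l s w) (x - y)
        + l * θ * s * deriv (conv θ (fun w => G α θ l s w)) (x - y) := by
  set m : ℝ := (α / 2 + l * (Real.exp (θ / 2) - 1)) * s with hm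
  set p : ℕ → ℝ := fun n => Real.exp (-(l * s)) * ((l * s) ^ n / (Nat.factorial n : ℝ)) with hpdef
  set v : ℕ → ℝ := fun n => α * s + (n : ℝ) * θ with hvdef
  set v₀ : ℝ := α * s
  have h₀ : 0 < v₀ := mul_pos hα hs
  have hp : Summable p := (Real.summable_pow_div_factorial (l * s)).mul_left _
  have hp₀ : ∀ n, 0 ≤ p n := fun n => by simp only [hpdef]; positivity
  have hv : ∀ n, v₀ ≤ v n := fun n => le_add_of_nonneg_right (by positivity)
  have hv' : ∀ n, v₀ ≤ v n + θ := fun n => (hv n).trans (le_add_of_nonneg_right hθ.le)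
  have hG : (fun w => G α θ l s w) = fun w => ∑' n, p n * centeredGaussian (v n) (w - m) := by
    funext w
    rw [G, ← tsum_mul_left]
    exact tsum_congr fun n => (mul_assoc _ _ _).symm
  have hG' : deriv (fun w => G α θ l s w) (x - y) =
      ∑' n, p n * (-((x - y - m) / v n) * centeredGaussian (v n) (x - y - m)) := by
    rw [hG]
    exact ((hasDerivAt_mixture hp hp₀ h₀ hv (x - y - m)).comp_sub_const (x - y) m).deriv
  have hC' : deriv (conv θ (fun w => G α θ l s w)) (x - y) =
      ∑' n, p n * (-((x - y - m) / (v n + θ)) * centeredGaussian (v n + θ) (x - y - m)) := by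
    rw [hG, funext (conv_mixture hp hp₀ h₀ hv hθ m)]
    exact ((hasDerivAt_mixture hp hp₀ h₀ hv' (x - y - m)).comp_sub_const (x - y) m).deriv
  rw [hG', hC', congrFun hG (x - y)]
  set u : ℝ := x - y - m with hu
  set D : ℕ → ℝ := fun n => -(u / v n) * centeredGaussian (v n) u with hD
  have hsD : Summable fun n => p n * D n := summable_deriv_mixture hp hp₀ h₀ hv u
  have hpsucc : ∀ n, l * s * p n = ((n + 1 : ℕ) : ℝ) * p (n + 1) := fun n => by
    simp only [hpdef, Nat.factorial_succ, Nat.cast_mul, pow_succ]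
    field_simp
  have hvsucc : ∀ n, v n + θ = v (n + 1) := fun n => by
    simp only [hvdef]; push_cast; ring
  have hshift : ∀ n, l * θ * s * (p n * (-(u / (v n + θ)) * centeredGaussian (v n + θ) u)) =
      ((n + 1 : ℕ) : ℝ) * θ * (p (n + 1) * D (n + 1)) := fun n => by
    rw [hvsucc]
    linear_combination θ * D (n + 1) * hpsucc n
  have hsN : Summable fun n : ℕ => (n : ℝ) * θ * (p n * D n) := by
    rw [← summable_nat_add_iff 1]
    refine Summable.congr ?_ hshift
    exact (summable_deriv_mixture hp hp₀ h₀ hv' u).mul_left _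
  have hjump : l * θ * s *
      ∑' n, p n * (-(u / (v n + θ)) * centeredGaussian (v n + θ) u) =
      ∑' n : ℕ, (n : ℝ) * θ * (p n * D n) := by
    rw [← tsum_mul_left, tsum_congr hshift, hsN.tsum_eq_zero_add]
    simp
  have hmain : v₀ * ∑' n, p n * D n + ∑' n : ℕ, (n : ℝ) * θ * (p n * D n) =
      -u * ∑' n, p n * centeredGaussian (v n) u := by
    rw [← tsum_mul_left, ← tsum_mul_left, ← (hsD.mul_left v₀).tsum_add hsN]
    refine tsum_congr fun n => ?_
    have hvn : v n ≠ 0 := (h₀.trans_le (hv n)).ne'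
    have : v₀ + (n : ℝ) * θ = v n := rfl
    rw [← add_mul, this]
    simp only [hD]
    field_simp
  rw [hjump]
  linear_combination -hmain
end
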